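/- For all integers n ≥ 1 and m ≥ 5n + 3, the Ramsey number R(W_m, B_n) equals 2m + 1; that is, every graph Γ on 2m + 1 vertices contains a copy of the wheel W_m or its complement contains a copy of the book B_n, and this fails for some graph on 2m vertices. -/

import Mathlib

open SimpleGraph

/-- `ContainsCopy Γ H` : `Γ` contains a copy of `H`, i.e. `H` is isomorphic to a subgraph
of `Γ`; equivalently, there is an injective graph homomorphism from `H` to `Γ`. -/
def ContainsCopy {α β : Type*} (Γ : SimpleGraph α) (H : SimpleGraph β) : Prop :=
  ∃ f : H →g Γ, Function.Injective f

/-- The wheel graph `W_m` on `m+1` vertices: the join of a single hub vertex (`none`)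
with the cycle `C_m` (on the vertices `some i`). -/
def wheelGraph (m : ℕ) : SimpleGraph (Option (Fin m)) :=
  SimpleGraph.fromRel (fun x y =>
    x = none ∨ ∃ i j : Fin m, x = some i ∧ y = some j ∧ (SimpleGraph.cycleGraph m).Adj i j)

/-- The book graph `B_n`: the join of `K_2` with the empty graph on `n` vertices, i.e.
`n` triangles sharing a common edge. -/
def bookGraph (n : ℕ) : SimpleGraph (Fin 2 ⊕ Fin n) :=
  SimpleGraph.fromRel (fun x y => x.isLeft ∧ x ≠ y)

section

open scoped Classical

variable {V : Type*} {G : SimpleGraph V}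

/-- The neighbours of `v` which lie in `s`. -/
noncomputable def nbrIn (G : SimpleGraph V) (s : Finset V) (v : V) : Finset V :=
  s.filter (G.Adj v)

theorem mem_nbrIn {s : Finset V} {v x : V} : x ∈ nbrIn G s v ↔ x ∈ s ∧ G.Adj v x :=
  Finset.mem_filter

theorem nbrIn_subset {s : Finset V} {v : V} : nbrIn G s v ⊆ s :=
  Finset.filter_subset _ _

/-- `SpanningPath G s a b`: the vertices of `s` can be ordered into a path of `G` from `a` to `b`. -/
inductive SpanningPath (G : SimpleGraph V) : Finset V → V → V → Prop
  | single (a : V) : SpanningPath G {a} a a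
  | cons {s : Finset V} {a b c : V} : a ∉ s → G.Adj a b → SpanningPath G s b c →
      SpanningPath G (insert a s) a c

/-- `SpanningCycle G s`: the induced subgraph of `G` on `s` has a Hamiltonian path with adjacent
ends (so a Hamiltonian cycle as soon as `s` has at least three vertices). -/
def SpanningCycle (G : SimpleGraph V) (s : Finset V) : Prop :=
  ∃ a b, SpanningPath G s a b ∧ G.Adj a b

namespace SpanningPath

theorem left_mem {s : Finset V} {a b : V} (h : SpanningPath G s a b) : a ∈ s := by
  cases h <;> simp

theorem right_mem {s : Finset V} {a b : V} (h : SpanningPath G s a b) : b ∈ s := by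
  induction h <;> simp_all

theorem append {s t : Finset V} {a b c d : V} (h₁ : SpanningPath G s a b)
    (h₂ : SpanningPath G t c d) (hst : Disjoint s t) (hbc : G.Adj b c) :
    SpanningPath G (s ∪ t) a d := by
  induction h₁ with
  | single a =>
    rw [← Finset.insert_eq]
    exact cons (by simpa using hst) hbc h₂
  | cons ha hab _ ih =>
    rw [Finset.disjoint_insert_left] at hst
    rw [Finset.insert_union]
    exact cons (by simp [ha, hst.1]) hab (ih hst.2 hbc)

theorem symm {s : Finset V} {a b : V} (h : SpanningPath G s a b) : SpanningPath G s b a := by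
  induction h with
  | single a => exact single a
  | cons ha hab _ ih =>
    rw [Finset.insert_eq, Finset.union_comm]
    exact ih.append (single _) (by simpa using ha) hab.symm

/-- The predecessor map of a spanning path, together with the splittings of the path which it
induces. -/
theorem exists_pred {s : Finset V} {a b : V} (h : SpanningPath G s a b) :
    ∃ π : V → V, Set.InjOn π (s.erase a) ∧
      (∀ y ∈ s.erase a, π y ∈ s.erase b ∧
        ∃ A C, Disjoint A C ∧ A ∪ C = s ∧ SpanningPath G A a (π y) ∧ SpanningPath G C y b) ∧
      ∀ x ∈ s.erase a, ∀ y ∈ s.erase a, x ≠ y →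
        (∃ A B C, Disjoint A B ∧ Disjoint A C ∧ Disjoint B C ∧ A ∪ B ∪ C = s ∧
          SpanningPath G A a (π x) ∧ SpanningPath G B x (π y) ∧ SpanningPath G C y b) ∨
        (∃ A B C, Disjoint A B ∧ Disjoint A C ∧ Disjoint B C ∧ A ∪ B ∪ C = s ∧
          SpanningPath G A a (π y) ∧ SpanningPath G B y (π x) ∧ SpanningPath G C x b) := by
  induction h with
  | single a => exact ⟨id, by simp, by simp, by simp⟩
  | @cons s a b c ha hab hs ih =>
    obtain ⟨π, hinj, h2, h3⟩ := ih
    have hbs := hs.left_mem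
    have hcs := hs.right_mem
    have hp : ∀ y ∈ s, y ≠ b → π y ∈ s ∧ π y ≠ c := fun y hy hyb => by
      have := (h2 y (by simp [hy, hyb])).1
      simpa [and_comm] using this
    rw [Finset.erase_insert ha]
    refine ⟨fun y => if y = b then a else π y, ?_, ?_, ?_⟩
    · intro x hx y hy hxy
      simp only [Finset.mem_coe] at hx hy
      by_cases hxb : x = b <;> by_cases hyb : y = b <;> simp only [hxb, hyb, if_true, if_false] at hxy ⊢
      · exact absurd (hxy ▸ (hp y hy hyb).1) ha
      · exact absurd (hxy ▸ (hp x hx hxb).1) ha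
      · exact hinj (by simp [hx, hxb]) (by simp [hy, hyb]) hxy
    · intro y hy
      by_cases hyb : y = b
      · subst hyb
        refine ⟨by
          have hac : a ≠ c := by rintro rfl; exact ha hcs
          simpa using hac, {a}, s, by simpa using ha, by
          rw [← Finset.insert_eq], ?_, hs⟩
        simpa using single a
      · obtain ⟨A, C, hAC, rfl, hA, hC⟩ := (h2 y (by simp [hy, hyb])).2
        have := hp y hy hyb
        simp only [hyb, if_false]
        refine ⟨Finset.mem_erase.2 ⟨this.2, Finset.mem_insert_of_mem this.1⟩, insert a A, C, ?_,
          by rw [Finset.insert_union], cons (by simp_all) hab hA, hC⟩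
        rw [Finset.disjoint_insert_left]
        exact ⟨by simp_all, hAC⟩
    · intro x hx y hy hxy
      wlog hxb : x ≠ b generalizing x y with H
      · have := H y hy x hx hxy.symm (by rintro rfl; simp_all)
        exact this.symm
      by_cases hyb : y = b
      · subst hyb
        right
        obtain ⟨A, C, hAC, rfl, hA, hC⟩ := (h2 x (by simp [hx, hxb])).2
        simp only [hxb, if_false, if_true]
        refine ⟨{a}, A, C, by simp_all, by simp_all, hAC, ?_, single a, hA, hC⟩
        rw [← Finset.insert_eq, Finset.insert_union]
      · simp only [hxb, hyb, if_false]
        rcases h3 x (by simp [hx, hxb]) y (by simp [hy, hyb]) hxy with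
          ⟨A, B, C, h1, h2, h4, rfl, h5, h6, h7⟩ | ⟨A, B, C, h1, h2, h4, rfl, h5, h6, h7⟩
        · exact .inl ⟨insert a A, B, C, by simp_all [Finset.disjoint_insert_left],
            by simp_all [Finset.disjoint_insert_left], h4, by simp [Finset.insert_union],
            cons (by simp_all) hab h5, h6, h7⟩
        · exact .inr ⟨insert a A, B, C, by simp_all [Finset.disjoint_insert_left],
            by simp_all [Finset.disjoint_insert_left], h4, by simp [Finset.insert_union],
            cons (by simp_all) hab h5, h6, h7⟩

/-- A spanning path whose ends have large degree sum closes up to a spanning cycle. -/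
theorem spanningCycle {s : Finset V} {a b : V} (h : SpanningPath G s a b)
    (hd : s.card ≤ (nbrIn G s a).card + (nbrIn G s b).card) :
    SpanningCycle G s := by
  obtain ⟨π, hinj, h2, -⟩ := h.exists_pred
  have hsub : nbrIn G s a ⊆ s.erase a := fun x hx => by
    simp only [mem_nbrIn, Finset.mem_erase] at hx ⊢
    exact ⟨hx.2.ne', hx.1⟩
  have hne : ¬ Disjoint ((nbrIn G s a).image π) (nbrIn G s b) := by
    intro hdis
    have h1 := Finset.card_union_of_disjoint hdis
    rw [Finset.card_image_of_injOn (hinj.mono (by exact_mod_cast hsub))] at h1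
    have h3 : (nbrIn G s a).image π ∪ nbrIn G s b ⊆ s.erase b := by
      apply Finset.union_subset
      · intro x hx
        obtain ⟨y, hy, rfl⟩ := Finset.mem_image.1 hx
        exact (h2 y (hsub hy)).1
      · intro x hx
        simp only [mem_nbrIn, Finset.mem_erase] at hx ⊢
        exact ⟨hx.2.ne', hx.1⟩
    have h4 := Finset.card_le_card h3
    rw [Finset.card_erase_of_mem h.right_mem] at h4
    have := Finset.card_pos.2 ⟨b, h.right_mem⟩
    omega
  rw [Finset.not_disjoint_iff] at hne
  obtain ⟨x, hx, hxb⟩ := hne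
  obtain ⟨y, hy, rfl⟩ := Finset.mem_image.1 hx
  obtain ⟨-, A, C, hAC, rfl, hA, hC⟩ := h2 y (hsub hy)
  simp only [mem_nbrIn] at hy hxb
  exact ⟨π y, b, hA.symm.append hC hAC hy.2, hxb.2.symm⟩

/-- Splitting a spanning path at an edge which is removed from the graph. -/
theorem split_edge {H : SimpleGraph V} {s : Finset V} {a b x y : V} (h : SpanningPath H s a b)
    (hH : ∀ u v, H.Adj u v → G.Adj u v ∨ (u = x ∧ v = y) ∨ (u = y ∧ v = x)) :
    SpanningPath G s a b ∨ ∃ A C, Disjoint A C ∧ A ∪ C = s ∧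
      ((SpanningPath G A a x ∧ SpanningPath G C y b) ∨
        (SpanningPath G A a y ∧ SpanningPath G C x b)) := by
  induction h with
  | single a => exact .inl (single a)
  | @cons s a b c ha hab hs ih =>
    rcases ih with ih | ⟨A, C, hAC, rfl, ih⟩
    · rcases hH _ _ hab with h | ⟨rfl, rfl⟩ | ⟨rfl, rfl⟩
      · exact .inl (cons ha h ih)
      · exact .inr ⟨{a}, s, by simpa using ha, (Finset.insert_eq _ _).symm,
          .inl ⟨single a, ih⟩⟩
      · exact .inr ⟨{a}, s, by simpa using ha, (Finset.insert_eq _ _).symm,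
          .inr ⟨single a, ih⟩⟩
    · have hx : a ≠ x := by
        rintro rfl
        rcases ih with ih | ih
        · exact ha (Finset.mem_union_left _ ih.1.right_mem)
        · exact ha (Finset.mem_union_right _ ih.2.left_mem)
      have hy : a ≠ y := by
        rintro rfl
        rcases ih with ih | ih
        · exact ha (Finset.mem_union_right _ ih.2.left_mem)
        · exact ha (Finset.mem_union_left _ ih.1.right_mem)
      have hab' : G.Adj a b := by
        rcases hH _ _ hab with h | ⟨rfl, rfl⟩ | ⟨rfl, rfl⟩
        · exact h
        · exact absurd rfl hx
        · exact absurd rfl hy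
      right
      refine ⟨insert a A, C, by simp_all [Finset.disjoint_insert_left], Finset.insert_union _ _ _, ?_⟩
      have haA : a ∉ A := fun h => ha (Finset.mem_union_left _ h)
      exact ih.imp (fun h => ⟨cons haA hab' h.1, h.2⟩) (fun h => ⟨cons haA hab' h.1, h.2⟩)

theorem top {s : Finset V} {a b : V} (ha : a ∈ s) (hb : b ∈ s) (hab : a ≠ b) :
    SpanningPath ⊤ s a b := by
  induction hk : s.card generalizing s a with
  | zero => simp_all
  | succ k ih =>
    rw [← Finset.insert_erase ha]
    by_cases h : ∃ c ∈ s, c ≠ a ∧ c ≠ b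
    · obtain ⟨c, hc, hca, hcb⟩ := h
      exact cons (by simp) hca.symm (ih (by simp [hc, hca]) (by simp [hb, hab.symm]) hcb
        (by rw [Finset.card_erase_of_mem ha]; omega))
    · push Not at h
      have : s.erase a = {b} := by
        ext c
        simp only [Finset.mem_erase, Finset.mem_singleton]
        constructor
        · rintro ⟨h1, h2⟩
          exact h c h2 h1
        · rintro rfl
          exact ⟨hab.symm, hb⟩
      rw [this]
      exact cons (by simpa using hab) (by simpa using hab) (single b)

/-- Two disjoint spanning paths whose inner ends have large degree sum can be
merged into one path with the same outer ends. -/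
theorem merge {A C : Finset V} {a b x y : V} (hA : SpanningPath G A a x)
    (hC : SpanningPath G C y b) (hAC : Disjoint A C)
    (hd : (A ∪ C).card + 1 ≤
      (nbrIn G (A ∪ C) x).card + (nbrIn G (A ∪ C) y).card) :
    SpanningPath G (A ∪ C) a b := by
  obtain ⟨π, hinj, h2, -⟩ := hA.exists_pred
  obtain ⟨ρ, hinj', h2', -⟩ := hC.exists_pred
  have hcA := Finset.card_pos.2 ⟨a, hA.left_mem⟩
  have hcC := Finset.card_pos.2 ⟨b, hC.right_mem⟩
  have key : (∃ w ∈ A.erase a, G.Adj y w ∧ G.Adj x (π w)) ∨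
      ∃ w ∈ C.erase y, G.Adj y w ∧ G.Adj x (ρ w) := by
    by_contra hcon
    push Not at hcon
    have aux : ∀ (S : Finset V) (c d : V) (τ : V → V), c ∈ S → d ∈ S → Set.InjOn τ (S.erase c) →
        (∀ w ∈ S.erase c, τ w ∈ S.erase d) →
        (∀ w ∈ S.erase c, G.Adj y w → ¬ G.Adj x (τ w)) →
        (nbrIn G (S.erase c) y).card + (nbrIn G (S.erase d) x).card + 1 ≤ S.card := by
      intro S c d τ hc hd hτ hm hn
      rw [← Finset.card_image_of_injOn (s := nbrIn G (S.erase c) y) (f := τ)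
        (hτ.mono (by exact_mod_cast nbrIn_subset)), ← Finset.card_union_of_disjoint]
      · rw [← Finset.card_erase_add_one hd, Nat.add_le_add_iff_right]
        apply Finset.card_le_card
        apply Finset.union_subset
        · intro z hz
          obtain ⟨w, hw, rfl⟩ := Finset.mem_image.1 hz
          exact hm w (mem_nbrIn.1 hw).1
        · exact nbrIn_subset
      · rw [Finset.disjoint_left]
        intro z hz hz'
        obtain ⟨w, hw, rfl⟩ := Finset.mem_image.1 hz
        rw [mem_nbrIn] at hw hz'
        exact hn w hw.1 hw.2 hz'.2
    have e1 := aux A a x π hA.left_mem hA.right_mem hinj (fun w hw => (h2 w hw).1) hcon.1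
    have e2 := aux C y b ρ hC.left_mem hC.right_mem hinj' (fun w hw => (h2' w hw).1) hcon.2
    have e3 := Finset.card_union_of_disjoint hAC
    have f1 : nbrIn G (A ∪ C) x ⊆ insert b (nbrIn G (A.erase x) x ∪
        nbrIn G (C.erase b) x) := by
      intro z hz
      simp only [mem_nbrIn, Finset.mem_union, Finset.mem_insert, Finset.mem_erase] at hz ⊢
      have := hz.2.ne'
      tauto
    have f2 : nbrIn G (A ∪ C) y ⊆ insert a (nbrIn G (A.erase a) y ∪
        nbrIn G (C.erase y) y) := by
      intro z hz
      simp only [mem_nbrIn, Finset.mem_union, Finset.mem_insert, Finset.mem_erase] at hz ⊢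
      have := hz.2.ne'
      tauto
    have g1 := (Finset.card_le_card f1).trans ((Finset.card_insert_le _ _).trans
      (Nat.succ_le_succ (Finset.card_union_le _ _)))
    have g2 := (Finset.card_le_card f2).trans ((Finset.card_insert_le _ _).trans
      (Nat.succ_le_succ (Finset.card_union_le _ _)))
    omega
  rcases key with ⟨w, hw, hyw, hxw⟩ | ⟨w, hw, hyw, hxw⟩
  · obtain ⟨-, A₁, A₂, hd1, rfl, hA1, hA2⟩ := h2 w hw
    rw [Finset.disjoint_union_left] at hAC
    exact (hA1.append hA2.symm hd1 hxw.symm).append hC (Finset.disjoint_union_left.2 hAC) hyw.symm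
  · obtain ⟨-, C₁, C₂, hd1, rfl, hC1, hC2⟩ := h2' w hw
    exact hA.append (hC1.symm.append hC2 hd1 hyw) hAC hxw

/-- Ore's condition for Hamilton-connectedness. -/
theorem of_ore {s : Finset V} {a b : V} (ha : a ∈ s) (hb : b ∈ s) (hab : a ≠ b)
    (hd : ∀ x ∈ s, ∀ y ∈ s, x ≠ y → ¬ G.Adj x y →
      s.card + 1 ≤ (nbrIn G s x).card + (nbrIn G s y).card) :
    SpanningPath G s a b := by
  have key : ∀ F : Finset (Sym2 V),
      SpanningPath (G ⊔ SimpleGraph.fromEdgeSet (F : Set (Sym2 V))) s a b →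
        SpanningPath G s a b := by
    intro F
    induction F using Finset.induction_on with
    | empty => intro h; simpa using h
    | insert e F _ ih =>
      intro h
      induction e using Sym2.inductionOn with
      | hf x y =>
        set H := G ⊔ SimpleGraph.fromEdgeSet (F : Set (Sym2 V)) with hH
        apply ih
        have hsp := h.split_edge (G := H) (x := x) (y := y) (by
          intro u v huv
          simp only [SimpleGraph.sup_adj, SimpleGraph.fromEdgeSet_adj, Finset.coe_insert,
            Set.mem_insert_iff, Sym2.eq_iff, hH] at huv ⊢
          tauto)
        have mono : ∀ z, (nbrIn G s z).card ≤ (nbrIn H s z).card := fun z =>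
          Finset.card_le_card (fun w hw => by
            rw [mem_nbrIn] at hw ⊢
            exact ⟨hw.1, (le_sup_left : G ≤ H) hw.2⟩)
        have hd' : ∀ x ∈ s, ∀ y ∈ s, x ≠ y → ¬ H.Adj x y →
            s.card + 1 ≤ (nbrIn H s x).card + (nbrIn H s y).card := by
          intro x hx y hy hxy hn
          have := hd x hx y hy hxy (fun h => hn ((le_sup_left : G ≤ H) h))
          have := mono x
          have := mono y
          omega
        rcases hsp with h | ⟨A, C, hAC, rfl, ⟨h1, h2⟩ | ⟨h1, h2⟩⟩
        · exact h
        · by_cases hxy : H.Adj x y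
          · exact h1.append h2 hAC hxy
          · exact h1.merge h2 hAC (hd' x (Finset.mem_union_left _ h1.right_mem) y
              (Finset.mem_union_right _ h2.left_mem)
              (Finset.disjoint_iff_ne.1 hAC x h1.right_mem y h2.left_mem) hxy)
        · by_cases hxy : H.Adj y x
          · exact h1.append h2 hAC hxy
          · exact h1.merge h2 hAC (hd' y (Finset.mem_union_left _ h1.right_mem) x
              (Finset.mem_union_right _ h2.left_mem)
              (Finset.disjoint_iff_ne.1 hAC y h1.right_mem x h2.left_mem) hxy)
  have hall : ∀ {t : Finset V} {u v : V}, SpanningPath ⊤ t u v → t ⊆ s →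
      SpanningPath (G ⊔ SimpleGraph.fromEdgeSet ((s.sym2 : Finset (Sym2 V)) : Set (Sym2 V)))
        t u v := by
    intro t u v h
    induction h with
    | single a => exact fun _ => single a
    | cons ha hab h ih =>
      intro hsub
      rw [Finset.insert_subset_iff] at hsub
      refine cons ha ?_ (ih hsub.2)
      right
      simpa [hsub.1, hsub.2 h.left_mem] using hab
  exact key _ (hall (top ha hb hab) subset_rfl)

end SpanningPath

namespace SpanningCycle

/-- The predecessor map of a spanning cycle. -/
theorem exists_pred {s : Finset V} (h : SpanningCycle G s) :
    ∃ π : V → V, Set.InjOn π s ∧ (∀ x ∈ s, π x ∈ s ∧ SpanningPath G s x (π x)) ∧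
      ∀ x ∈ s, ∀ y ∈ s, x ≠ y → ∃ A B, Disjoint A B ∧ A ∪ B = s ∧
        SpanningPath G A x (π y) ∧ SpanningPath G B y (π x) := by
  obtain ⟨a, b, h, hab⟩ := h
  obtain ⟨π, hinj, h2, h3⟩ := h.exists_pred
  have ha := h.left_mem
  have hb := h.right_mem
  have hp : ∀ y ∈ s, y ≠ a → π y ∈ s ∧ π y ≠ b := fun y hy hyb => by
    have := (h2 y (by simp [hy, hyb])).1
    simpa [and_comm] using this
  refine ⟨fun y => if y = a then b else π y, ?_, ?_, ?_⟩
  · intro x hx y hy hxy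
    simp only [Finset.mem_coe] at hx hy
    by_cases hxb : x = a <;> by_cases hyb : y = a <;>
      simp only [hxb, hyb, if_true, if_false] at hxy ⊢
    · exact absurd hxy.symm (hp y hy hyb).2
    · exact absurd hxy (hp x hx hxb).2
    · exact hinj (by simp [hx, hxb]) (by simp [hy, hyb]) hxy
  · intro x hx
    by_cases hxa : x = a
    · subst hxa
      simpa using ⟨hb, h⟩
    · simp only [hxa, if_false]
      obtain ⟨A, C, hAC, hs, hA, hC⟩ := (h2 x (by simp [hx, hxa])).2
      refine ⟨(hp x hx hxa).1, ?_⟩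
      rw [← hs, Finset.union_comm]
      exact hC.append hA hAC.symm hab.symm
  · intro x hx y hy hxy
    wlog hya : y ≠ a generalizing x y with H
    · obtain ⟨A, B, h1, h2, h3, h4⟩ := H y hy x hx hxy.symm (by rintro rfl; simp_all)
      exact ⟨B, A, h1.symm, by rw [Finset.union_comm, h2], h4, h3⟩
    by_cases hxa : x = a
    · subst hxa
      simp only [hya, if_true, if_false]
      exact (h2 y (by simp [hy, hya])).2
    · simp only [hxa, hya, if_false]
      rcases h3 x (by simp [hx, hxa]) y (by simp [hy, hya]) hxy with
          ⟨A, B, C, h1, hAC, h4, rfl, h5, h6, h7⟩ | ⟨A, B, C, h1, hAC, h4, rfl, h5, h6, h7⟩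
      · refine ⟨B, C ∪ A, ?_, ?_, h6, h7.append h5 hAC.symm hab.symm⟩
        · rw [Finset.disjoint_union_right]; exact ⟨h4, h1.symm⟩
        · ext; simp only [Finset.mem_union]; tauto
      · refine ⟨C ∪ A, B, ?_, ?_, h7.append h5 hAC.symm hab.symm, h6⟩
        · rw [Finset.disjoint_union_left]; exact ⟨h4.symm, h1⟩
        · ext; simp only [Finset.mem_union]; tauto

end SpanningCycle

/-- A spanning path as a sequence of vertices. -/
theorem SpanningPath.exists_seq {s : Finset V} {a b : V} (h : SpanningPath G s a b) :
    ∃ f : ℕ → V, f 0 = a ∧ f (s.card - 1) = b ∧ (∀ i < s.card, f i ∈ s) ∧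
      (∀ i < s.card, ∀ j < s.card, f i = f j → i = j) ∧
      ∀ i, i + 1 < s.card → G.Adj (f i) (f (i + 1)) := by
  induction h with
  | single a => exact ⟨fun _ => a, by simp⟩
  | @cons s a b c ha hab hs ih =>
    obtain ⟨f, h0, hl, hm, hinj, hadj⟩ := ih
    have hc := Finset.card_pos.2 ⟨b, hs.left_mem⟩
    rw [Finset.card_insert_of_notMem ha]
    refine ⟨fun i => if i = 0 then a else f (i - 1), by simp, ?_, ?_, ?_, ?_⟩
    · simpa [hc.ne'] using hl
    · intro i hi
      by_cases h : i = 0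
      · simp [h]
      · simp only [h, if_false]
        exact Finset.mem_insert_of_mem (hm _ (by omega))
    · intro i hi j hj hij
      by_cases h : i = 0 <;> by_cases h' : j = 0 <;> simp only [h, h', if_true, if_false] at hij ⊢
      · exact absurd (hij ▸ hm (j - 1) (by omega)) ha
      · exact absurd (hij ▸ hm (i - 1) (by omega)) ha
      · have := hinj _ (by omega) _ (by omega) hij
        omega
    · intro i hi
      by_cases h : i = 0
      · simpa [h, h0] using hab
      · obtain ⟨k, rfl⟩ := Nat.exists_eq_succ_of_ne_zero h
        simpa using hadj k (by omega)

/-- A spanning cycle in the neighbourhood of a vertex gives a wheel. -/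
theorem SpanningCycle.containsCopy_wheelGraph {s : Finset V} (hs : SpanningCycle G s) {h : V}
    (hh : ∀ x ∈ s, G.Adj h x) : ContainsCopy G (wheelGraph s.card) := by
  obtain ⟨a, b, hp, hab⟩ := hs
  obtain ⟨f, h0, hl, hm, hinj, hadj⟩ := hp.exists_seq
  generalize s.card = m at *
  have hcyc : ∀ i j : Fin m, (j - i).val = 1 → G.Adj (f i) (f j) := by
    intro i j hij
    rw [Fin.sub_def] at hij
    simp only at hij
    have hi := i.isLt
    have hj := j.isLt
    by_cases hle : (i : ℕ) ≤ j
    · rw [show m - (i : ℕ) + j = j - i + m by omega, Nat.add_mod_right,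
        Nat.mod_eq_of_lt (by omega)] at hij
      have := hadj i (by omega)
      rwa [show (i : ℕ) + 1 = j by omega] at this
    · rw [Nat.mod_eq_of_lt (by omega)] at hij
      rw [show (i : ℕ) = m - 1 by omega, show (j : ℕ) = 0 by omega, h0, hl]
      exact hab.symm
  have hadj' : ∀ i j : Fin m, (cycleGraph m).Adj i j → G.Adj (f i) (f j) := by
    intro i j hij
    rw [SimpleGraph.cycleGraph_adj'] at hij
    rcases hij with h | h
    · exact (hcyc j i h).symm
    · exact hcyc i j h
  have half : ∀ x y : Option (Fin m), x ≠ y →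
      (x = none ∨ ∃ i j : Fin m, x = some i ∧ y = some j ∧ (cycleGraph m).Adj i j) →
      G.Adj (x.elim h fun i => f i) (y.elim h fun i => f i) := by
    rintro x y hxy (rfl | ⟨i, j, rfl, rfl, hij⟩)
    · cases y with
      | none => exact absurd rfl hxy
      | some j => exact hh _ (hm j j.isLt)
    · exact hadj' i j hij
  refine ⟨⟨fun x => x.elim h fun i => f i, ?_⟩, ?_⟩
  · intro x y hxy
    rw [wheelGraph, SimpleGraph.fromRel_adj] at hxy
    rcases hxy.2 with h | h
    · exact half x y hxy.1 h
    · exact (half y x hxy.1.symm h).symm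
  · intro x y hxy
    cases x with
    | none => cases y with
      | none => rfl
      | some j => exact absurd hxy (hh _ (hm j j.isLt)).ne
    | some i => cases y with
      | none => exact absurd hxy (hh _ (hm i i.isLt)).ne'
      | some j => exact congrArg some (Fin.ext (hinj i i.isLt j j.isLt hxy))

/-- A blue edge together with `n` common blue neighbours gives a book in the complement. -/
theorem containsCopy_bookGraph {u w : V} {n : ℕ} {s : Finset V} (huw : Gᶜ.Adj u w)
    (hs : ∀ x ∈ s, Gᶜ.Adj u x ∧ Gᶜ.Adj w x) (hn : n ≤ s.card) :
    ContainsCopy Gᶜ (bookGraph n) := by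
  obtain ⟨t, hts, rfl⟩ := Finset.exists_subset_card_eq hn
  let e := t.equivFin.symm
  have he : ∀ i, Gᶜ.Adj u (e i) ∧ Gᶜ.Adj w (e i) := fun i => hs _ (hts (e i).2)
  let f : Fin 2 ⊕ Fin t.card → V := Sum.elim ![u, w] fun i => e i
  have half : ∀ x y : Fin 2 ⊕ Fin t.card, x ≠ y → x.isLeft → Gᶜ.Adj (f x) (f y) := by
    rintro (x | x) (y | y) hxy hx
    · fin_cases x <;> fin_cases y <;> simp [f] at hxy ⊢
      · simpa using huw
      · simpa using huw.symm
    · fin_cases x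
      · exact (he y).1
      · exact (he y).2
    · simp at hx
    · simp at hx
  refine ⟨⟨f, ?_⟩, ?_⟩
  · intro x y hxy
    rw [bookGraph, SimpleGraph.fromRel_adj] at hxy
    rcases hxy.2 with h | h
    · exact half x y hxy.1 h.1
    · exact (half y x hxy.1.symm h.1).symm
  · intro x y hxy
    by_contra hne
    by_cases hx : x.isLeft
    · exact (half x y hne hx).ne hxy
    · by_cases hy : y.isLeft
      · exact (half y x (Ne.symm hne) hy).ne' hxy
      · cases x with
        | inl => simp at hx
        | inr i => cases y with
          | inl => simp at hy
          | inr j => exact hne (congrArg Sum.inr (e.injective (Subtype.ext hxy)))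

/-- Every vertex of `s` has fewer than `n` non-neighbours in `s`. -/
def NearClique (G : SimpleGraph V) (n : ℕ) (s : Finset V) : Prop :=
  ∀ x ∈ s, (nbrIn Gᶜ s x).card < n

/-- There are no edges of `G` between the disjoint sets `P` and `Q`. -/
def Anticomplete (G : SimpleGraph V) (P Q : Finset V) : Prop :=
  ∀ p ∈ P, ∀ q ∈ Q, Gᶜ.Adj p q

/-- The vertices of `s` are pairwise adjacent. -/
def PairwiseAdj (G : SimpleGraph V) (s : Finset V) : Prop :=
  ∀ x ∈ s, ∀ y ∈ s, x ≠ y → G.Adj x y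

/-- The complement of `G` contains no book with `n` pages. -/
def BookFree (G : SimpleGraph V) (n : ℕ) : Prop :=
  ∀ u w, Gᶜ.Adj u w → ∀ s : Finset V, (∀ x ∈ s, Gᶜ.Adj u x ∧ Gᶜ.Adj w x) → s.card < n

/-- No neighbourhood contains a spanning cycle on `m` vertices. -/
def WheelFree (G : SimpleGraph V) (m : ℕ) : Prop :=
  ∀ h, ∀ s : Finset V, s.card = m → (∀ x ∈ s, G.Adj h x) → ¬ SpanningCycle G s

theorem Anticomplete.symm {P Q : Finset V} (h : Anticomplete G P Q) : Anticomplete G Q P :=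
  fun q hq p hp => (h p hp q hq).symm

theorem Anticomplete.disjoint {P Q : Finset V} (h : Anticomplete G P Q) : Disjoint P Q :=
  Finset.disjoint_left.2 fun x hx hx' => (h x hx x hx').ne rfl

theorem PairwiseAdj.mono {s t : Finset V} (h : PairwiseAdj G t) (hst : s ⊆ t) :
    PairwiseAdj G s :=
  fun x hx y hy => h x (hst hx) y (hst hy)

theorem NearClique.mono {n : ℕ} {s t : Finset V} (h : NearClique G n t) (hst : s ⊆ t) :
    NearClique G n s := fun x hx =>
  (Finset.card_le_card (fun y hy => by
    rw [mem_nbrIn] at hy ⊢; exact ⟨hst hy.1, hy.2⟩)).trans_lt (h x (hst hx))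

theorem nbrIn_mono {s t : Finset V} (h : s ⊆ t) (x : V) : nbrIn G s x ⊆ nbrIn G t x :=
  fun y hy => by rw [mem_nbrIn] at hy ⊢; exact ⟨h hy.1, hy.2⟩

theorem card_nbrIn_of_mem {s : Finset V} {x : V} (hx : x ∈ s) :
    (nbrIn G s x).card + (nbrIn Gᶜ s x).card + 1 = s.card := by
  rw [← Finset.card_erase_add_one hx, ← Finset.card_union_of_disjoint]
  · congr 2
    ext y
    simp only [Finset.mem_union, mem_nbrIn, SimpleGraph.compl_adj, Finset.mem_erase]
    have : G.Adj x y → x ≠ y := fun h => h.ne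
    have := @eq_comm _ x y
    tauto
  · rw [Finset.disjoint_left]
    intro y hy hy'
    rw [mem_nbrIn] at hy hy'
    exact ((SimpleGraph.compl_adj _ _ _).1 hy'.2).2 hy.2

theorem card_nbrIn_of_notMem {s : Finset V} {x : V} (hx : x ∉ s) :
    (nbrIn G s x).card + (nbrIn Gᶜ s x).card = s.card := by
  rw [← Finset.card_union_of_disjoint]
  · congr 1
    ext y
    simp only [Finset.mem_union, mem_nbrIn, SimpleGraph.compl_adj]
    have : y ∈ s → x ≠ y := by rintro h rfl; exact hx h
    tauto
  · rw [Finset.disjoint_left]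
    intro y hy hy'
    rw [mem_nbrIn] at hy hy'
    exact ((SimpleGraph.compl_adj _ _ _).1 hy'.2).2 hy.2

theorem BookFree.nearClique {n : ℕ} (hB : BookFree G n) {u : V} {s : Finset V}
    (hs : ∀ x ∈ s, Gᶜ.Adj u x) : NearClique G n s := fun x hx =>
  hB u x (hs x hx) _ fun y hy => by
    rw [mem_nbrIn] at hy
    exact ⟨hs y hy.1, hy.2⟩

theorem BookFree.pairwiseAdj {n : ℕ} (hB : BookFree G n) {P Q : Finset V}
    (h : Anticomplete G P Q) (hQ : n ≤ Q.card) : PairwiseAdj G P := by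
  intro x hx y hy hxy
  by_contra hn
  exact (hB x y ((SimpleGraph.compl_adj _ _ _).2 ⟨hxy, hn⟩) Q
    fun q hq => ⟨h x hx q hq, h y hy q hq⟩).not_ge hQ

/-- Near-cliques are Hamilton-connected. -/
theorem NearClique.spanningPath {n : ℕ} {s : Finset V} (h : NearClique G n s)
    (hs : n ≤ 1 ∨ 2 * n + 1 ≤ s.card) {a b : V} (ha : a ∈ s) (hb : b ∈ s) (hab : a ≠ b) :
    SpanningPath G s a b := by
  refine SpanningPath.of_ore ha hb hab fun x hx y hy hxy hn => ?_
  have h1 := h x hx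
  have h2 := h y hy
  have h3 := card_nbrIn_of_mem (G := G) hx
  have h4 := card_nbrIn_of_mem (G := G) hy
  have h5 : 0 < (nbrIn Gᶜ s x).card :=
    Finset.card_pos.2 ⟨y, mem_nbrIn.2 ⟨hy, (SimpleGraph.compl_adj _ _ _).2 ⟨hxy, hn⟩⟩⟩
  omega

theorem NearClique.spanningCycle {n : ℕ} {s : Finset V} (h : NearClique G n s)
    (hs : 2 * n + 1 ≤ s.card) : SpanningCycle G s := by
  obtain ⟨a, ha⟩ : s.Nonempty := Finset.card_pos.1 (by omega)
  have h1 := h a ha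
  have h2 := card_nbrIn_of_mem (G := G) ha
  obtain ⟨b, hb⟩ : (nbrIn G s a).Nonempty := Finset.card_pos.1 (by omega)
  rw [mem_nbrIn] at hb
  exact ⟨a, b, h.spanningPath (.inr hs) ha hb.1 hb.2.ne, hb.2⟩

theorem PairwiseAdj.nearClique {s : Finset V} (h : PairwiseAdj G s) : NearClique G 1 s := by
  intro x hx
  rw [Nat.lt_one_iff, Finset.card_eq_zero, Finset.eq_empty_iff_forall_notMem]
  intro y hy
  rw [mem_nbrIn, SimpleGraph.compl_adj] at hy
  exact hy.2.2 (h x hx y hy.1 hy.2.1)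

theorem PairwiseAdj.spanningPath {s : Finset V} (h : PairwiseAdj G s) {a b : V} (ha : a ∈ s)
    (hb : b ∈ s) (hab : a ≠ b) : SpanningPath G s a b :=
  h.nearClique.spanningPath (.inl le_rfl) ha hb hab

/-- Two vertices, each in a clique or with two neighbours in it, are joined by a path spanning the
clique together with these vertices. -/
theorem PairwiseAdj.spanningPath_insert {K : Finset V} (hK : PairwiseAdj G K) {a b : V}
    (hab : a ≠ b) (ha : a ∈ K ∨ 1 < (nbrIn G K a).card) (hb : b ∈ K ∨ 1 < (nbrIn G K b).card) :
    SpanningPath G (insert a (insert b K)) a b := by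
  by_cases hbK : b ∈ K
  · rw [Finset.insert_eq_of_mem hbK]
    by_cases haK : a ∈ K
    · rw [Finset.insert_eq_of_mem haK]
      exact hK.spanningPath haK hbK hab
    · obtain ⟨k, hk, hkb⟩ := Finset.exists_mem_ne (ha.resolve_left haK) b
      rw [mem_nbrIn] at hk
      exact .cons haK hk.2 (hK.spanningPath hk.1 hbK hkb)
  · have hb' := hb.resolve_left hbK
    by_cases haK : a ∈ K
    · obtain ⟨k, hk, hka⟩ := Finset.exists_mem_ne hb' a
      rw [mem_nbrIn] at hk
      rw [Finset.insert_eq_of_mem (Finset.mem_insert_of_mem haK)]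
      exact (SpanningPath.cons hbK hk.2 (hK.spanningPath hk.1 haK hka)).symm
    · obtain ⟨k, hk⟩ := Finset.card_pos.1 (zero_lt_one.trans (ha.resolve_left haK))
      obtain ⟨l, hl, hlk⟩ := Finset.exists_mem_ne hb' k
      rw [mem_nbrIn] at hk hl
      refine .cons (by simp [haK, hab]) hk.2 ?_
      exact (SpanningPath.cons hbK hl.2 (hK.spanningPath hl.1 hk.1 hlk)).symm

/-- A bipartite relation without two disjoint edges is covered by one vertex. -/
theorem exists_star [Nonempty V] (A B : Finset V)
    (h : ∀ a ∈ A, ∀ b ∈ B, ∀ a' ∈ A, ∀ b' ∈ B, a ≠ a' → b ≠ b' → G.Adj a b → ¬ G.Adj a' b') :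
    ∃ c, ∀ a ∈ A, ∀ b ∈ B, G.Adj a b → a = c ∨ b = c := by
  by_cases h0 : ∃ a ∈ A, ∃ b ∈ B, G.Adj a b
  · obtain ⟨a, ha, b, hb, hab⟩ := h0
    by_cases h1 : ∀ a' ∈ A, ∀ b' ∈ B, G.Adj a' b' → a' = a
    · exact ⟨a, fun x hx y hy hxy => .inl (h1 x hx y hy hxy)⟩
    · push Not at h1
      obtain ⟨a', ha', b', hb', hab', hne⟩ := h1
      have hbb : b' = b := by
        by_contra hbb
        exact h a' ha' b' hb' a ha b hb hne hbb hab' hab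
      subst hbb
      refine ⟨b', fun x hx y hy hxy => ?_⟩
      by_contra hcon
      push Not at hcon
      by_cases hxa : x = a
      · subst hxa
        exact h x hx y hy a' ha' b' hb' hne.symm hcon.2 hxy hab'
      · exact h x hx y hy a ha b' hb hxa hcon.2 hxy hab
  · push Not at h0
    exact ⟨Classical.arbitrary V, fun a ha b hb hab => absurd hab (h0 a ha b hb)⟩

theorem SpanningPath.spanningCycle_union {s t : Finset V} {a b c d : V}
    (hs : SpanningPath G s a b) (ht : SpanningPath G t c d) (hst : Disjoint s t)
    (hac : G.Adj a c) (hbd : G.Adj b d) : SpanningCycle G (s ∪ t) :=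
  ⟨b, d, hs.symm.append ht hst hac, hbd⟩

/-- `R` is, up to one vertex, the union of two nonempty sets without edges of `G` between them. -/
def AlmostSplit (G : SimpleGraph V) (R : Finset V) : Prop :=
  ∃ P Q : Finset V, P ⊆ R ∧ Q ⊆ R ∧ P.Nonempty ∧ Q.Nonempty ∧ Anticomplete G P Q ∧
    R.card ≤ P.card + Q.card + 1

/-- Two disjoint cliques without edges between them either extend to an almost splitting of `R`
or lie on a cycle of moderate length. -/
theorem AlmostSplit.of_cliques {n : ℕ} (hn : 1 ≤ n) (hB : BookFree G n) {R X Y : Finset V}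
    (hXR : X ⊆ R) (hYR : Y ⊆ R) (hXY : Anticomplete G X Y) (hX : X.card = 2 * n)
    (hY : Y.card = 2 * n) :
    AlmostSplit G R ∨ ∃ C ⊆ R, SpanningCycle G C ∧ 3 * n + 1 ≤ C.card ∧ C.card ≤ 4 * n + 4 := by
  have hXc := hB.pairwiseAdj hXY (by omega)
  have hYc := hB.pairwiseAdj hXY.symm (by omega)
  have : Nonempty V := ⟨(Finset.card_pos.1 (by omega : 0 < X.card)).choose⟩
  set A := R.filter fun z => (nbrIn Gᶜ X z).card < n with hA
  set B := R.filter fun z => ¬ (nbrIn Gᶜ X z).card < n with hB'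
  have hAB : Disjoint A B := Finset.disjoint_filter_filter_not _ _ _
  have hcard : A.card + B.card = R.card := Finset.card_filter_add_card_filter_not _
  have hXA : X ⊆ A := fun x hx => Finset.mem_filter.2
    ⟨hXR hx, (hXc.nearClique x hx).trans_le hn⟩
  have hYB : Y ⊆ B := fun y hy => Finset.mem_filter.2 ⟨hYR hy, by
    have : nbrIn Gᶜ X y = X := Finset.Subset.antisymm nbrIn_subset fun x hx =>
      mem_nbrIn.2 ⟨hx, (hXY x hx y hy).symm⟩
    rw [this]; omega⟩
  have hAX : ∀ a ∈ A, a ∈ X ∨ 1 < (nbrIn G X a).card := by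
    intro a ha
    by_contra hcon
    push Not at hcon
    have h1 := card_nbrIn_of_notMem (G := G) hcon.1
    have h2 := (Finset.mem_filter.1 ha).2
    omega
  have hBY : ∀ b ∈ B, b ∈ Y ∨ 1 < (nbrIn G Y b).card := by
    intro b hb
    by_contra hcon
    push Not at hcon
    have h2 := (Finset.mem_filter.1 hb).2
    have h3 : nbrIn G Y b = Y := Finset.Subset.antisymm nbrIn_subset fun y hy => by
      refine mem_nbrIn.2 ⟨hy, ?_⟩
      by_contra hn'
      refine h2 (hB b y ((SimpleGraph.compl_adj _ _ _).2 ⟨?_, hn'⟩) _ fun x hx => ?_)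
      · rintro rfl; exact hcon.1 hy
      · rw [mem_nbrIn] at hx
        exact ⟨hx.2, (hXY x hx.1 y hy).symm⟩
    rw [h3] at hcon
    omega
  by_cases hstar : ∀ a ∈ A, ∀ b ∈ B, ∀ a' ∈ A, ∀ b' ∈ B, a ≠ a' → b ≠ b' →
      G.Adj a b → ¬ G.Adj a' b'
  · left
    obtain ⟨c, hc⟩ := exists_star A B hstar
    have hA2 : X.card ≤ A.card := Finset.card_le_card hXA
    have hB2 : Y.card ≤ B.card := Finset.card_le_card hYB
    have e1 : A.card ≤ (A.erase c).card + 1 := by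
      have := Finset.pred_card_le_card_erase (s := A) (a := c); omega
    have e2 : B.card ≤ (B.erase c).card + 1 := by
      have := Finset.pred_card_le_card_erase (s := B) (a := c); omega
    refine ⟨A.erase c, B.erase c, (Finset.erase_subset _ _).trans (Finset.filter_subset _ _),
      (Finset.erase_subset _ _).trans (Finset.filter_subset _ _), Finset.card_pos.1 (by omega),
      Finset.card_pos.1 (by omega), ?_, ?_⟩
    · intro p hp q hq
      rw [Finset.mem_erase] at hp hq
      rw [SimpleGraph.compl_adj]
      refine ⟨Finset.disjoint_iff_ne.1 hAB p hp.2 q hq.2, fun hpq => ?_⟩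
      rcases hc p hp.2 q hq.2 hpq with h | h
      · exact hp.1 h
      · exact hq.1 h
    · by_cases hcA : c ∈ A
      · rw [Finset.erase_eq_of_notMem (Finset.disjoint_left.1 hAB hcA)]; omega
      · rw [Finset.erase_eq_of_notMem hcA]; omega
  · right
    push Not at hstar
    obtain ⟨a, ha, b, hb, a', ha', b', hb', hne, hne', hab, hab'⟩ := hstar
    have hsA : insert a (insert a' X) ⊆ A := by
      simp only [Finset.insert_subset_iff]; exact ⟨ha, ha', hXA⟩
    have hsB : insert b (insert b' Y) ⊆ B := by
      simp only [Finset.insert_subset_iff]; exact ⟨hb, hb', hYB⟩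
    have hd := Finset.disjoint_of_subset_left hsA (Finset.disjoint_of_subset_right hsB hAB)
    have c1 := Finset.card_union_of_disjoint hd
    have c2 := Finset.card_insert_le a (insert a' X)
    have c3 := Finset.card_insert_le a' X
    have c4 := Finset.card_insert_le b (insert b' Y)
    have c5 := Finset.card_insert_le b' Y
    have c6 := Finset.card_le_card (Finset.subset_insert a (insert a' X))
    have c7 := Finset.card_le_card (Finset.subset_insert a' X)
    have c8 := Finset.card_le_card (Finset.subset_insert b (insert b' Y))
    have c9 := Finset.card_le_card (Finset.subset_insert b' Y)
    refine ⟨_, ?_, (hXc.spanningPath_insert hne (hAX a ha) (hAX a' ha')).spanningCycle_union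
      (hYc.spanningPath_insert hne' (hBY b hb) (hBY b' hb')) hd hab hab', by omega, by omega⟩
    exact Finset.union_subset (hsA.trans (Finset.filter_subset _ _))
      (hsB.trans (Finset.filter_subset _ _))

theorem AlmostSplit.of_nearCliques {n : ℕ} (hn : 1 ≤ n) (hB : BookFree G n) {R X Y : Finset V}
    (hXR : X ⊆ R) (hYR : Y ⊆ R) (hXY : Disjoint X Y) (hX : NearClique G n X)
    (hY : NearClique G n Y) (hXc : X.card = 2 * n + 1) (hYc : Y.card = 2 * n + 1) :
    AlmostSplit G R ∨ ∃ C ⊆ R, SpanningCycle G C ∧ 3 * n + 1 ≤ C.card ∧ C.card ≤ 4 * n + 4 := by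
  have : Nonempty V := ⟨(Finset.card_pos.1 (by omega : 0 < X.card)).choose⟩
  by_cases hstar : ∀ a ∈ X, ∀ b ∈ Y, ∀ a' ∈ X, ∀ b' ∈ Y, a ≠ a' → b ≠ b' →
      G.Adj a b → ¬ G.Adj a' b'
  · obtain ⟨c, hc⟩ := exists_star X Y hstar
    have e1 := Finset.pred_card_le_card_erase (s := X) (a := c)
    have e2 := Finset.pred_card_le_card_erase (s := Y) (a := c)
    obtain ⟨X', hX', hX'c⟩ := Finset.exists_subset_card_eq (show 2 * n ≤ (X.erase c).card by omega)
    obtain ⟨Y', hY', hY'c⟩ := Finset.exists_subset_card_eq (show 2 * n ≤ (Y.erase c).card by omega)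
    refine of_cliques hn hB ((hX'.trans (Finset.erase_subset _ _)).trans hXR)
      ((hY'.trans (Finset.erase_subset _ _)).trans hYR) ?_ hX'c hY'c
    intro p hp q hq
    have hp := Finset.mem_erase.1 (hX' hp)
    have hq := Finset.mem_erase.1 (hY' hq)
    rw [SimpleGraph.compl_adj]
    refine ⟨Finset.disjoint_iff_ne.1 hXY p hp.2 q hq.2, fun hpq => ?_⟩
    rcases hc p hp.2 q hq.2 hpq with h | h
    · exact hp.1 h
    · exact hq.1 h
  · right
    push Not at hstar
    obtain ⟨a, ha, b, hb, a', ha', b', hb', hne, hne', hab, hab'⟩ := hstar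
    have c1 := Finset.card_union_of_disjoint hXY
    exact ⟨X ∪ Y, Finset.union_subset hXR hYR,
      (hX.spanningPath (.inr hXc.ge) ha ha' hne).spanningCycle_union
        (hY.spanningPath (.inr hYc.ge) hb hb' hne') hXY hab hab', by omega, by omega⟩

theorem exists_disjoint_subsets {k : ℕ} {X Y : Finset V} (hX : k ≤ X.card) (hY : k ≤ Y.card)
    (hXY : 2 * k ≤ (X ∪ Y).card) :
    ∃ X' Y', X' ⊆ X ∧ Y' ⊆ Y ∧ Disjoint X' Y' ∧ X'.card = k ∧ Y'.card = k := by
  have e1 := Finset.card_sdiff_add_card X Y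
  by_cases h : k ≤ (X \ Y).card
  · obtain ⟨X', hX', hc⟩ := Finset.exists_subset_card_eq h
    obtain ⟨Y', hY', hc'⟩ := Finset.exists_subset_card_eq hY
    exact ⟨X', Y', hX'.trans Finset.sdiff_subset, hY', Finset.disjoint_of_subset_left hX'
      (Finset.disjoint_of_subset_right hY' Finset.sdiff_disjoint), hc, hc'⟩
  · obtain ⟨X', h1, h2, hc⟩ := Finset.exists_subsuperset_card_eq
      (Finset.sdiff_subset : X \ Y ⊆ X) (by omega) hX
    have e2 := Finset.card_le_card (show X ∪ Y ⊆ X' ∪ (Y \ X') by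
      intro z hz
      have := @h1 z
      simp only [Finset.mem_union, Finset.mem_sdiff] at *
      tauto)
    have e3 := Finset.card_union_le X' (Y \ X')
    obtain ⟨Y', hY', hc'⟩ := Finset.exists_subset_card_eq (show k ≤ (Y \ X').card by omega)
    exact ⟨X', Y', h2, hY'.trans Finset.sdiff_subset, Finset.disjoint_of_subset_right hY'
      Finset.disjoint_sdiff, hc, hc'⟩

/-- A large set almost splits or contains a cycle of moderate length. -/
theorem almostSplit_or_exists_spanningCycle {n m : ℕ} (hn : 1 ≤ n) (hm : 5 * n + 3 ≤ m)
    (hB : BookFree G n) {R : Finset V} (hR : m ≤ R.card) :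
    AlmostSplit G R ∨ ∃ C ⊆ R, SpanningCycle G C ∧ 3 * n + 1 ≤ C.card ∧ C.card ≤ m := by
  obtain ⟨S, hSR, hS⟩ := Finset.exists_subset_card_eq hR
  by_cases hore : ∀ x ∈ S, ∀ y ∈ S, x ≠ y → ¬ G.Adj x y →
      S.card + 1 ≤ (nbrIn G S x).card + (nbrIn G S y).card
  · right
    have hex : ∃ a ∈ S, ∃ b ∈ S, G.Adj a b := by
      by_contra hcon
      push Not at hcon
      obtain ⟨a, ha, b, hb, hab⟩ := Finset.one_lt_card.1 (by omega : 1 < S.card)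
      have := hore a ha b hb hab (hcon a ha b hb)
      have h0 : ∀ x ∈ S, (nbrIn G S x).card = 0 := fun x hx => by
        rw [Finset.card_eq_zero, Finset.eq_empty_iff_forall_notMem]
        intro y hy
        rw [mem_nbrIn] at hy
        exact hcon x hx y hy.1 hy.2
      rw [h0 a ha, h0 b hb] at this
      omega
    obtain ⟨a, ha, b, hb, hab⟩ := hex
    exact ⟨S, hSR, ⟨a, b, SpanningPath.of_ore ha hb hab.ne hore, hab⟩, by omega, by omega⟩
  · push Not at hore
    obtain ⟨u, hu, w, hw, huw, hadj, hlt⟩ := hore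
    wlog hle : (nbrIn Gᶜ S w).card ≤ (nbrIn Gᶜ S u).card generalizing u w with H
    · exact H w hw u hu huw.symm (fun h => hadj h.symm) (by omega) (by omega)
    have e1 := card_nbrIn_of_mem (G := G) hu
    have e2 := card_nbrIn_of_mem (G := G) hw
    have hX : NearClique G n (nbrIn Gᶜ S u) := hB.nearClique fun x hx => (mem_nbrIn.1 hx).2
    have hY : NearClique G n (nbrIn Gᶜ S w) := hB.nearClique fun x hx => (mem_nbrIn.1 hx).2
    have hXS : nbrIn Gᶜ S u ⊆ S := nbrIn_subset
    have hYS : nbrIn Gᶜ S w ⊆ S := nbrIn_subset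
    by_cases hXc : 3 * n + 1 ≤ (nbrIn Gᶜ S u).card
    · exact .inr ⟨_, hXS.trans hSR, hX.spanningCycle (by omega), hXc,
        (Finset.card_le_card hXS).trans hS.le⟩
    · have hcap : (nbrIn Gᶜ S u ∩ nbrIn Gᶜ S w).card < n :=
        hB u w ((SimpleGraph.compl_adj _ _ _).2 ⟨huw, hadj⟩) _ fun x hx => by
          rw [Finset.mem_inter, mem_nbrIn, mem_nbrIn] at hx
          exact ⟨hx.1.2, hx.2.2⟩
      have e3 := Finset.card_union_add_card_inter (nbrIn Gᶜ S u) (nbrIn Gᶜ S w)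
      obtain ⟨X', Y', h1, h2, hd, hc1, hc2⟩ := exists_disjoint_subsets (k := 2 * n + 1)
        (X := nbrIn Gᶜ S u) (Y := nbrIn Gᶜ S w) (by omega) (by omega) (by omega)
      refine (AlmostSplit.of_nearCliques hn hB ((h1.trans hXS).trans hSR)
        ((h2.trans hYS).trans hSR) hd (hX.mono h1) (hY.mono h2) hc1 hc2).imp_right ?_
      rintro ⟨C, hC, hC', h3, h4⟩
      exact ⟨C, hC, hC', h3, by omega⟩

/-- A vertex outside a long cycle which cannot be inserted has at most one neighbour on it. -/
theorem card_nbrIn_le_one_of_not_spanningCycle_insert {n : ℕ} (hB : BookFree G n) {C : Finset V}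
    (hC : SpanningCycle G C) (hc : 3 * n + 1 ≤ C.card) {h : V} (hh : h ∉ C)
    (hmax : ¬ SpanningCycle G (insert h C)) : (nbrIn G C h).card ≤ 1 := by
  by_contra hcon
  push Not at hcon
  obtain ⟨π, hinj, h1, h2⟩ := hC.exists_pred
  set N := nbrIn G C h with hN
  have hNC : N ⊆ C := nbrIn_subset
  have hπh : ∀ x ∈ N, Gᶜ.Adj h (π x) := by
    intro x hx
    have hxC := hNC hx
    rw [SimpleGraph.compl_adj]
    refine ⟨fun he => hh (he ▸ (h1 x hxC).1), fun hadj => hmax ?_⟩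
    exact ⟨h, π x, .cons hh (mem_nbrIn.1 hx).2 (h1 x hxC).2, hadj⟩
  have hpair : ∀ x ∈ N, ∀ y ∈ N, x ≠ y → Gᶜ.Adj (π x) (π y) ∧
      (nbrIn G C (π x)).card + (nbrIn G C (π y)).card ≤ C.card := by
    intro x hx y hy hxy
    obtain ⟨A, B, hAB, hU, hA, hB'⟩ := h2 x (hNC hx) y (hNC hy) hxy
    have hp : SpanningPath G (insert h C) (π y) (π x) := by
      have hhB : h ∉ B := fun h' => hh (hU ▸ Finset.mem_union_right _ h')
      have hhA : h ∉ A := fun h' => hh (hU ▸ Finset.mem_union_left _ h')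
      rw [← hU, ← Finset.union_insert]
      exact hA.symm.append (.cons hhB (mem_nbrIn.1 hy).2 hB')
        (Finset.disjoint_insert_right.2 ⟨hhA, hAB⟩) (mem_nbrIn.1 hx).2.symm
    constructor
    · rw [SimpleGraph.compl_adj]
      exact ⟨fun he => hxy (hinj (hNC hx) (hNC hy) he), fun hadj => hmax ⟨_, _, hp, hadj.symm⟩⟩
    · by_contra hlt
      refine hmax (hp.spanningCycle ?_)
      have e1 := Finset.card_le_card (nbrIn_mono (G := G) (Finset.subset_insert h C) (π x))
      have e2 := Finset.card_le_card (nbrIn_mono (G := G) (Finset.subset_insert h C) (π y))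
      rw [Finset.card_insert_of_notMem hh]
      omega
  obtain ⟨x, hx, y, hy, hxy⟩ := Finset.one_lt_card.1 hcon
  obtain ⟨hab, hdeg⟩ := hpair x hx y hy hxy
  have ea := card_nbrIn_of_mem (G := G) (h1 x (hNC hx)).1
  have eb := card_nbrIn_of_mem (G := G) (h1 y (hNC hy)).1
  have eh := card_nbrIn_of_notMem (G := G) hh
  rw [← hN] at eh
  have hah := hπh x hx
  have hbh := hπh y hy
  set a := π x
  set b := π y
  set A := nbrIn Gᶜ C a
  set B := nbrIn Gᶜ C b
  set H := nbrIn Gᶜ C h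
  have i1 : (A ∩ H).card < n := hB a h hah.symm _ fun z hz => by
    rw [Finset.mem_inter, mem_nbrIn, mem_nbrIn] at hz
    exact ⟨hz.1.2, hz.2.2⟩
  have i2 : (B ∩ H).card < n := hB b h hbh.symm _ fun z hz => by
    rw [Finset.mem_inter, mem_nbrIn, mem_nbrIn] at hz
    exact ⟨hz.1.2, hz.2.2⟩
  have i3 : (A ∩ B).card + 1 < n := by
    rw [← Finset.card_insert_of_notMem (a := h)
      (fun h' => hh (nbrIn_subset (Finset.mem_inter.1 h').1))]
    refine hB a b hab _ fun z hz => ?_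
    rw [Finset.mem_insert, Finset.mem_inter, mem_nbrIn, mem_nbrIn] at hz
    rcases hz with rfl | hz
    · exact ⟨hah.symm, hbh.symm⟩
    · exact ⟨hz.1.2, hz.2.2⟩
  have i4 : N.card ≤ ((A ∩ H) ∩ (B ∩ H)).card + 2 := by
    have hsub : ((N.erase x).erase y).image π ⊆ (A ∩ H) ∩ (B ∩ H) := by
      intro w hw
      obtain ⟨z, hz, rfl⟩ := Finset.mem_image.1 hw
      simp only [Finset.mem_erase] at hz
      have hzC := (h1 z (hNC hz.2.2)).1
      have q1 := (hpair x hx z hz.2.2 (Ne.symm hz.2.1)).1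
      have q2 := (hpair y hy z hz.2.2 (Ne.symm hz.1)).1
      have q3 := hπh z hz.2.2
      simp only [Finset.mem_inter]
      exact ⟨⟨mem_nbrIn.2 ⟨hzC, q1⟩, mem_nbrIn.2 ⟨hzC, q3⟩⟩,
        mem_nbrIn.2 ⟨hzC, q2⟩, mem_nbrIn.2 ⟨hzC, q3⟩⟩
    have e1 := Finset.card_le_card hsub
    rw [Finset.card_image_of_injOn (hinj.mono (by
      exact_mod_cast ((Finset.erase_subset _ _).trans (Finset.erase_subset _ _)).trans hNC))] at e1
    have e2 := Finset.pred_card_le_card_erase (s := N) (a := x)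
    have e3 := Finset.pred_card_le_card_erase (s := N.erase x) (a := y)
    omega
  have u1 := Finset.card_union_add_card_inter A B
  have u2 := Finset.card_union_add_card_inter (A ∪ B) H
  rw [Finset.union_inter_distrib_right] at u2
  have u3 := Finset.card_union_add_card_inter (A ∩ H) (B ∩ H)
  have u4 : ((A ∪ B) ∪ H).card ≤ C.card := Finset.card_le_card
    (Finset.union_subset (Finset.union_subset nbrIn_subset nbrIn_subset) nbrIn_subset)
  omega

theorem AlmostSplit.of_card_nbrIn_le_one {n : ℕ} (hn : 1 ≤ n) (hB : BookFree G n)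
    {R C : Finset V} (hCR : C ⊆ R) (hc : 3 * n + 1 ≤ C.card) (hlt : C.card < R.card)
    (hmax : ∀ D ⊆ R, D.card = C.card + 1 → ¬ SpanningCycle G D)
    (hone : ∀ h ∈ R \ C, (nbrIn G C h).card ≤ 1) : AlmostSplit G R := by
  have hRC := Finset.card_sdiff_add_card_eq_card hCR
  have hblue : ∀ h ∈ R \ C, ∀ x ∈ C, G.Adj h x → ∀ y ∈ C, y ≠ x → Gᶜ.Adj h y := by
    intro h hh x hx hhx y hy hyx
    rw [SimpleGraph.compl_adj]
    refine ⟨?_, fun hhy => ?_⟩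
    · rintro rfl
      exact (Finset.mem_sdiff.1 hh).2 hy
    · exact hyx (Finset.card_le_one.1 (hone h hh) y (mem_nbrIn.2 ⟨hy, hhy⟩) x
        (mem_nbrIn.2 ⟨hx, hhx⟩))
  by_cases hex : ∃ h₁ ∈ R \ C, ∃ h₂ ∈ R \ C, ∃ x₁ ∈ C, ∃ x₂ ∈ C, x₁ ≠ x₂ ∧
      G.Adj h₁ x₁ ∧ G.Adj h₂ x₂
  · exfalso
    obtain ⟨h₁, hh₁, h₂, hh₂, x₁, hx₁, x₂, hx₂, hne, ha₁, ha₂⟩ := hex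
    have hb₁ := hblue h₁ hh₁ x₁ hx₁ ha₁
    have hb₂ := hblue h₂ hh₂ x₂ hx₂ ha₂
    have hhne : h₁ ≠ h₂ := by
      rintro rfl
      exact ((SimpleGraph.compl_adj _ _ _).1 (hb₁ x₂ hx₂ hne.symm)).2 ha₂
    have c1 := Finset.card_erase_add_one hx₁
    have c2 := Finset.card_erase_add_one hx₂
    have hh : G.Adj h₁ h₂ := by
      by_contra hcon
      have := hB h₁ h₂ ((SimpleGraph.compl_adj _ _ _).2 ⟨hhne, hcon⟩) ((C.erase x₁).erase x₂)
        fun z hz => by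
          simp only [Finset.mem_erase] at hz
          exact ⟨hb₁ z hz.2.2 hz.2.1, hb₂ z hz.2.2 hz.1⟩
      have := Finset.pred_card_le_card_erase (s := C.erase x₁) (a := x₂)
      omega
    have hM₁ : NearClique G n (C.erase x₁) := hB.nearClique (u := h₁) fun z hz => by
      rw [Finset.mem_erase] at hz
      exact hb₁ z hz.2 hz.1
    have hM₂ : NearClique G n (C.erase x₂) := hB.nearClique (u := h₂) fun z hz => by
      rw [Finset.mem_erase] at hz
      exact hb₂ z hz.2 hz.1
    have hx₁' : x₁ ∈ C.erase x₂ := Finset.mem_erase.2 ⟨hne, hx₁⟩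
    have d1 := card_nbrIn_of_mem (G := G) hx₁'
    have d2 := hM₂ x₁ hx₁'
    obtain ⟨x, hx⟩ : (nbrIn G (C.erase x₂) x₁).Nonempty := Finset.card_pos.1 (by omega)
    rw [mem_nbrIn, Finset.mem_erase] at hx
    obtain ⟨⟨hxx₂, hxC⟩, hadj⟩ := hx
    obtain ⟨M, hxM, hMC, hMcard⟩ := Finset.exists_subsuperset_card_eq (n := C.card - 2)
      (show ({x, x₂} : Finset V) ⊆ C.erase x₁ by
        intro z hz
        simp only [Finset.mem_insert, Finset.mem_singleton] at hz
        rcases hz with rfl | rfl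
        · exact Finset.mem_erase.2 ⟨hadj.ne', hxC⟩
        · exact Finset.mem_erase.2 ⟨hne.symm, hx₂⟩)
      (Finset.card_le_two.trans (by omega)) (by omega)
    have hp := (hM₁.mono hMC).spanningPath (by omega) (hxM (by simp) : x ∈ M)
      (hxM (by simp) : x₂ ∈ M) hxx₂
    have hMC' : M ⊆ C := hMC.trans (Finset.erase_subset _ _)
    rw [Finset.mem_sdiff] at hh₁ hh₂
    have hx₁M : x₁ ∉ M := fun h => (Finset.mem_erase.1 (hMC h)).1 rfl
    have hq : SpanningPath G (insert h₂ (insert h₁ {x₁})) h₂ x₁ := by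
      refine .cons ?_ hh.symm (.cons ?_ ha₁ (.single _))
      · simp only [Finset.mem_insert, Finset.mem_singleton, not_or]
        exact ⟨hhne.symm, fun h => hh₂.2 (h ▸ hx₁)⟩
      · rw [Finset.mem_singleton]
        exact fun h => hh₁.2 (h ▸ hx₁)
    have hd : Disjoint M (insert h₂ (insert h₁ {x₁})) := by
      simp only [Finset.disjoint_insert_right, Finset.disjoint_singleton_right]
      exact ⟨fun h => hh₂.2 (hMC' h), fun h => hh₁.2 (hMC' h), hx₁M⟩
    refine hmax _ (Finset.union_subset (hMC'.trans hCR) ?_) ?_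
      ⟨_, _, hp.append hq hd ha₂.symm, hadj.symm⟩
    · simp only [Finset.insert_subset_iff, Finset.singleton_subset_iff]
      exact ⟨hh₂.1, hh₁.1, hCR hx₁⟩
    · rw [Finset.card_union_of_disjoint hd, Finset.card_insert_of_notMem,
        Finset.card_insert_of_notMem, Finset.card_singleton]
      · omega
      · rw [Finset.mem_singleton]
        exact fun h => hh₁.2 (h ▸ hx₁)
      · simp only [Finset.mem_insert, Finset.mem_singleton, not_or]
        exact ⟨hhne.symm, fun h => hh₂.2 (h ▸ hx₁)⟩
  · push Not at hex
    have hcover : ∃ x₀, ∀ h ∈ R \ C, ∀ x ∈ C, G.Adj h x → x = x₀ := by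
      by_cases h0 : ∃ h ∈ R \ C, ∃ x ∈ C, G.Adj h x
      · obtain ⟨h, hh, x, hx, hadj⟩ := h0
        refine ⟨x, fun h' hh' x' hx' hadj' => ?_⟩
        by_contra hne
        exact hex h hh h' hh' x hx x' hx' (Ne.symm hne) hadj hadj'
      · push Not at h0
        obtain ⟨x, -⟩ := Finset.card_pos.1 (by omega : 0 < C.card)
        exact ⟨x, fun h hh y hy hadj => absurd hadj (h0 h hh y hy)⟩
    obtain ⟨x₀, hx₀⟩ := hcover
    have e1 := Finset.pred_card_le_card_erase (s := C) (a := x₀)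
    refine ⟨R \ C, C.erase x₀, Finset.sdiff_subset, (Finset.erase_subset _ _).trans hCR,
      Finset.card_pos.1 (by omega), Finset.card_pos.1 (by omega), ?_, by omega⟩
    intro p hp q hq
    rw [Finset.mem_erase] at hq
    rw [SimpleGraph.compl_adj]
    refine ⟨?_, fun hadj => hq.1 (hx₀ p hp q hq.2 hadj)⟩
    rintro rfl
    exact (Finset.mem_sdiff.1 hp).2 hq.2

/-- A large set without a cycle on exactly `m` vertices almost splits. -/
theorem AlmostSplit.of_not_spanningCycle {n m : ℕ} (hn : 1 ≤ n) (hm : 5 * n + 3 ≤ m)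
    (hB : BookFree G n) {R : Finset V} (hR : m ≤ R.card)
    (hcyc : ∀ S ⊆ R, S.card = m → ¬ SpanningCycle G S) : AlmostSplit G R := by
  refine (almostSplit_or_exists_spanningCycle hn hm hB hR).elim id ?_
  rintro ⟨C₀, hC₀R, hC₀, hl, hu⟩
  obtain ⟨C, hC, hmax⟩ := Finset.exists_max_image
    (R.powerset.filter fun C => SpanningCycle G C ∧ 3 * n + 1 ≤ C.card ∧ C.card ≤ m)
    Finset.card ⟨C₀, by simpa [hC₀R, hC₀, hu] using hl⟩
  simp only [Finset.mem_filter, Finset.mem_powerset] at hC hmax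
  obtain ⟨hCR, hCc, hCl, hCu⟩ := hC
  have hlt : C.card < m := lt_of_le_of_ne hCu fun h => hcyc C hCR h hCc
  have hmax' : ∀ D ⊆ R, D.card = C.card + 1 → ¬ SpanningCycle G D := by
    intro D hD hDc hDs
    have := hmax D ⟨hD, hDs, by omega, by omega⟩
    omega
  refine .of_card_nbrIn_le_one hn hB hCR hCl (by omega) hmax' fun h hh => ?_
  rw [Finset.mem_sdiff] at hh
  exact card_nbrIn_le_one_of_not_spanningCycle_insert hB hCc hCl hh.2
    (hmax' _ (Finset.insert_subset hh.1 hCR) (Finset.card_insert_of_notMem hh.2))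

/-- In a wheel-free graph, large subsets of neighbourhoods almost split. -/
theorem WheelFree.almostSplit {n m : ℕ} (hn : 1 ≤ n) (hm : 5 * n + 3 ≤ m) (hB : BookFree G n)
    (hW : WheelFree G m) {h : V} {R : Finset V} (hh : ∀ x ∈ R, G.Adj h x) (hR : m ≤ R.card) :
    AlmostSplit G R :=
  .of_not_spanningCycle hn hm hB hR fun S hS hSc => hW h S hSc fun x hx => hh x (hS hx)

theorem NearClique.mono_right {k n : ℕ} {s : Finset V} (h : NearClique G k s) (hkn : k ≤ n) :
    NearClique G n s :=
  fun x hx => (h x hx).trans_le hkn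

theorem NearClique.union {n : ℕ} (hn : 1 ≤ n) {T P : Finset V} (hT : NearClique G n T)
    (hP : PairwiseAdj G P) (hTP : ∀ t ∈ T, ∀ p ∈ P, G.Adj t p) : NearClique G n (T ∪ P) := by
  intro x hx
  rcases Finset.mem_union.1 hx with hx | hx
  · refine (Finset.card_le_card fun y hy => ?_).trans_lt (hT x hx)
    rw [mem_nbrIn, Finset.mem_union] at hy
    refine mem_nbrIn.2 ⟨hy.1.resolve_right fun h => ?_, hy.2⟩
    exact ((SimpleGraph.compl_adj _ _ _).1 hy.2).2 (hTP x hx y h)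
  · have : nbrIn Gᶜ (T ∪ P) x = ∅ := by
      rw [Finset.eq_empty_iff_forall_notMem]
      intro y hy
      rw [mem_nbrIn, Finset.mem_union, SimpleGraph.compl_adj] at hy
      rcases hy.1 with h | h
      · exact hy.2.2 (hTP y h x hx).symm
      · exact hy.2.2 (hP x hx y h hy.2.1)
    rw [this, Finset.card_empty]
    omega

theorem WheelFree.card_lt_of_nearClique {n m : ℕ} (hm : 5 * n + 3 ≤ m) (hW : WheelFree G m)
    {X : Finset V} (hX : NearClique G n X) {h : V} (hh : ∀ x ∈ X, G.Adj h x) : X.card < m := by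
  by_contra hcon
  obtain ⟨S, hSX, hS⟩ := Finset.exists_subset_card_eq (not_lt.1 hcon)
  exact hW h S hS (fun x hx => hh x (hSX hx)) ((hX.mono hSX).spanningCycle (by omega))

theorem WheelFree.card_le_of_pairwiseAdj {m : ℕ} (hm : 8 ≤ m) (hW : WheelFree G m)
    {K : Finset V} (hK : PairwiseAdj G K) : K.card ≤ m := by
  by_contra hcon
  obtain ⟨k, hk⟩ := Finset.card_pos.1 (by omega : 0 < K.card)
  have := hW.card_lt_of_nearClique (n := 1) (by omega)
    (hK.mono (Finset.erase_subset k K)).nearClique fun x hx =>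
      hK k hk x (Finset.mem_of_mem_erase hx) (Finset.ne_of_mem_erase hx).symm
  rw [Finset.card_erase_of_mem hk] at this
  omega

theorem card_lt_of_anticomplete {n m : ℕ} (hn : 1 ≤ n) (hm : 5 * n + 3 ≤ m)
    (hB : BookFree G n) (hW : WheelFree G m) {P Q : Finset V} (hPQ : Anticomplete G P Q)
    (hP : P.Nonempty) {v : V} (hv : ∀ q ∈ Q, G.Adj v q) : Q.card < m := by
  by_contra hcon
  obtain ⟨P', Q', hP'Q, hQ'Q, ⟨p', hp'⟩, ⟨q', hq'⟩, hanti, hcard⟩ :=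
    hW.almostSplit hn hm hB hv (not_lt.1 hcon)
  obtain ⟨p, hp⟩ := hP
  have h1 := hB p p' (hPQ p hp p' (hP'Q hp')) Q'
    fun x hx => ⟨hPQ p hp x (hQ'Q hx), hanti p' hp' x hx⟩
  have h2 := hB p q' (hPQ p hp q' (hQ'Q hq')) P'
    fun x hx => ⟨hPQ p hp x (hP'Q hx), hanti.symm q' hq' x hx⟩
  omega

theorem card_sdiff_union_le_one {R P Q : Finset V} (hP : P ⊆ R) (hQ : Q ⊆ R)
    (hPQ : Anticomplete G P Q) (hcard : R.card ≤ P.card + Q.card + 1) :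
    (R \ (P ∪ Q)).card ≤ 1 := by
  have h1 := Finset.card_sdiff_add_card_eq_card (Finset.union_subset hP hQ)
  have h2 := Finset.card_union_of_disjoint hPQ.disjoint
  omega

/-- A near-clique lies on one side of an almost splitting. -/
theorem NearClique.disjoint_or_disjoint {n : ℕ} {R P Q X : Finset V} (hX : NearClique G n X)
    (hXn : 2 * n ≤ X.card) (hXR : X ⊆ R) (hP : P ⊆ R) (hQ : Q ⊆ R) (hPQ : Anticomplete G P Q)
    (hcard : R.card ≤ P.card + Q.card + 1) : Disjoint X P ∨ Disjoint X Q := by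
  by_contra hcon
  push Not at hcon
  obtain ⟨hp, hq⟩ := hcon
  rw [Finset.not_disjoint_iff] at hp hq
  obtain ⟨p, hpX, hpP⟩ := hp
  obtain ⟨q, hqX, hqQ⟩ := hq
  have h1 : (X ∩ Q).card < n := (Finset.card_le_card fun y hy => by
    rw [Finset.mem_inter] at hy
    exact mem_nbrIn.2 ⟨hy.1, hPQ p hpP y hy.2⟩).trans_lt (hX p hpX)
  have h2 : (X ∩ P).card < n := (Finset.card_le_card fun y hy => by
    rw [Finset.mem_inter] at hy
    exact mem_nbrIn.2 ⟨hy.1, hPQ.symm q hqQ y hy.2⟩).trans_lt (hX q hqX)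
  have h3 := card_sdiff_union_le_one hP hQ hPQ hcard
  have h4 : X ⊆ (X ∩ P ∪ X ∩ Q) ∪ R \ (P ∪ Q) := by
    intro x hx
    have := hXR hx
    simp only [Finset.mem_union, Finset.mem_inter, Finset.mem_sdiff]
    tauto
  have h5 := (Finset.card_le_card h4).trans ((Finset.card_union_le _ _).trans
    (Nat.add_le_add_right (Finset.card_union_le _ _) _))
  omega

/-- An almost splitting of the union of two near-cliques essentially separates them. -/
theorem AlmostSplit.exists_of_union {n : ℕ} {X Y : Finset V} (h : AlmostSplit G (X ∪ Y))
    (hX : NearClique G n X) (hXn : 2 * n ≤ X.card) (hY : NearClique G n Y)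
    (hYn : 2 * n ≤ Y.card) :
    ∃ P Q, P ⊆ X ∧ Q ⊆ Y ∧ Anticomplete G P Q ∧ (X ∪ Y).card ≤ P.card + Q.card + 1 := by
  obtain ⟨P, Q, hP, hQ, ⟨p, hp⟩, ⟨q, hq⟩, hPQ, hcard⟩ := h
  have key : ∀ {S : Finset V}, S ⊆ X ∪ Y → (Disjoint X S → S ⊆ Y) ∧ (Disjoint Y S → S ⊆ X) :=
    fun hS => ⟨fun hd x hx => (Finset.mem_union.1 (hS hx)).resolve_left
      (Finset.disjoint_right.1 hd hx), fun hd x hx => (Finset.mem_union.1 (hS hx)).resolve_right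
      (Finset.disjoint_right.1 hd hx)⟩
  rcases hX.disjoint_or_disjoint hXn Finset.subset_union_left hP hQ hPQ hcard with h1 | h1 <;>
  rcases hY.disjoint_or_disjoint hYn Finset.subset_union_right hP hQ hPQ hcard with h2 | h2
  · exact absurd ((key hP).1 h1 hp) (Finset.disjoint_right.1 h2 hp)
  · exact ⟨Q, P, (key hQ).2 h2, (key hP).1 h1, hPQ.symm, by omega⟩
  · exact ⟨P, Q, (key hP).2 h2, (key hQ).1 h1, hPQ, hcard⟩
  · exact absurd ((key hQ).1 h1 hq) (Finset.disjoint_right.1 h2 hq)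

theorem card_lt_of_clique {n m : ℕ} (hn : 1 ≤ n) (hm : 5 * n + 3 ≤ m) (hB : BookFree G n)
    (hW : WheelFree G m) {K A : Finset V} (hK : PairwiseAdj G K) (hKn : 2 * n + 1 ≤ K.card)
    (hKA : K ⊆ A) (hA : ∀ a ∈ A, (nbrIn Gᶜ K a).card < n) {p : V} (hp : p ∈ K) :
    (nbrIn G A p).card < m := by
  by_contra hcon
  obtain ⟨P, Q, hP, hQ, hPn, hQn, hPQ, hcard⟩ :=
    hW.almostSplit hn hm hB (fun x hx => (mem_nbrIn.1 hx).2) (not_lt.1 hcon)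
  have hKR : K.erase p ⊆ nbrIn G A p := fun x hx => by
    rw [Finset.mem_erase] at hx
    exact mem_nbrIn.2 ⟨hKA hx.2, hK p hp x hx.2 hx.1.symm⟩
  have hKp := Finset.card_erase_add_one hp
  have hside := ((hK.mono (Finset.erase_subset p K)).nearClique.mono_right hn).disjoint_or_disjoint
    (by omega) hKR hP hQ hPQ hcard
  wlog hd : Disjoint (K.erase p) P generalizing P Q with H
  · exact H Q P hQ hP hQn hPn hPQ.symm (by omega) hside.symm (hside.resolve_left hd)
  obtain ⟨w, hw⟩ := hPn
  have hwK : w ∉ K.erase p := Finset.disjoint_right.1 hd hw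
  have h1 := card_nbrIn_of_notMem (G := G) hwK
  have h2 := hA w (mem_nbrIn.1 (hP hw)).1
  have h3 := Finset.card_le_card (nbrIn_mono (G := Gᶜ) (Finset.erase_subset p K) w)
  have h4 := card_sdiff_union_le_one hP hQ hPQ hcard
  have h5 : nbrIn G (K.erase p) w ⊆ nbrIn G A p \ (P ∪ Q) := by
    intro x hx
    rw [mem_nbrIn] at hx
    rw [Finset.mem_sdiff, Finset.mem_union, not_or]
    refine ⟨hKR hx.1, Finset.disjoint_left.1 hd hx.1, fun hxQ => ?_⟩
    exact ((SimpleGraph.compl_adj _ _ _).1 (hPQ w hw x hxQ)).2 hx.2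
  have h6 := Finset.card_le_card h5
  omega

theorem sum_card_nbrIn_comm (P C : Finset V) :
    ∑ p ∈ P, (nbrIn G C p).card = ∑ z ∈ C, (nbrIn G P z).card := by
  have := Finset.sum_card_bipartiteAbove_eq_sum_card_bipartiteBelow (s := P) (t := C) G.Adj
  convert this using 3
  · rfl
  · ext x
    simp [mem_nbrIn, Finset.mem_bipartiteBelow, G.adj_comm]

theorem exists_card_nbrIn_small {n : ℕ} {P C : Finset V} (hP : 2 * n ≤ P.card)
    (hPne : P.Nonempty) (hC : ∀ z ∈ C, (nbrIn G P z).card < n) :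
    ∃ p ∈ P, 2 * (nbrIn G C p).card ≤ C.card := by
  by_contra hcon
  push Not at hcon
  have h1 : ∑ z ∈ C, (nbrIn G P z).card ≤ C.card * n :=
    Finset.sum_le_card_nsmul _ _ _ fun z hz => (hC z hz).le
  have h2 : P.card * (C.card + 1) ≤ ∑ p ∈ P, 2 * (nbrIn G C p).card :=
    by
    simpa using Finset.card_nsmul_le_sum P (fun p => 2 * (nbrIn G C p).card) (C.card + 1)
      fun p hp => hcon p hp
  rw [← Finset.mul_sum, sum_card_nbrIn_comm] at h2
  have h3 := Finset.card_pos.2 hPne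
  nlinarith

section Fintype

variable [Fintype V]

theorem not_anticomplete {n m : ℕ} (hn : 1 ≤ n) (hm : 5 * n + 3 ≤ m)
    (hV : Fintype.card V = 2 * m + 1) (hB : BookFree G n) (hW : WheelFree G m) {P Q : Finset V}
    (hP : 2 * n + 1 ≤ P.card) (hQ : 2 * n + 1 ≤ Q.card) : ¬ Anticomplete G P Q := by
  intro hPQ
  have hPc := hB.pairwiseAdj hPQ (by omega)
  have hQc := hB.pairwiseAdj hPQ.symm (by omega)
  set A : Finset V := Finset.univ.filter fun z => (nbrIn Gᶜ P z).card < n with hA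
  set B : Finset V := Finset.univ.filter fun z => (nbrIn Gᶜ Q z).card < n with hB'
  have hmA : ∀ z, z ∈ A ↔ (nbrIn Gᶜ P z).card < n := fun z => by simp [hA]
  have hmB : ∀ z, z ∈ B ↔ (nbrIn Gᶜ Q z).card < n := fun z => by simp [hB']
  have hPA : P ⊆ A := fun p hp => (hmA p).2 ((hPc.nearClique p hp).trans_le hn)
  have hQB : Q ⊆ B := fun q hq => (hmB q).2 ((hQc.nearClique q hq).trans_le hn)
  have hPz : ∀ p ∈ P, ∀ z, Gᶜ.Adj p z → z ∈ B := fun p hp z hpz =>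
    (hmB z).2 (hB p z hpz _ fun x hx => by
      rw [mem_nbrIn] at hx
      exact ⟨hPQ p hp x hx.1, hx.2⟩)
  have hQz : ∀ q ∈ Q, ∀ z, Gᶜ.Adj q z → z ∈ A := fun q hq z hqz =>
    (hmA z).2 (hB q z hqz _ fun x hx => by
      rw [mem_nbrIn] at hx
      exact ⟨hPQ.symm q hq x hx.1, hx.2⟩)
  have hAB : A ∪ B = Finset.univ := by
    rw [Finset.eq_univ_iff_forall]
    intro z
    by_contra hz
    rw [Finset.mem_union, not_or, hmA, not_lt] at hz
    obtain ⟨p, hp⟩ := Finset.card_pos.1 (by omega : 0 < (nbrIn Gᶜ P z).card)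
    rw [mem_nbrIn] at hp
    exact hz.2 (hPz p hp.1 z hp.2.symm)
  have hcard := Finset.card_union_add_card_inter A B
  rw [hAB, Finset.card_univ, hV] at hcard
  obtain ⟨p, hp, hpc⟩ := exists_card_nbrIn_small (G := Gᶜ) (n := n) (P := P) (C := A ∩ B)
    (by omega) (Finset.card_pos.1 (by omega)) fun z hz => (hmA z).1 (Finset.mem_inter.1 hz).1
  obtain ⟨q, hq, hqc⟩ := exists_card_nbrIn_small (G := Gᶜ) (n := n) (P := Q) (C := A ∩ B)
    (by omega) (Finset.card_pos.1 (by omega)) fun z hz => (hmB z).1 (Finset.mem_inter.1 hz).2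
  have h1 := card_lt_of_clique hn hm hB hW hPc hP hPA (fun a ha => (hmA a).1 ha) hp
  have h2 := card_lt_of_clique hn hm hB hW hQc hQ hQB (fun a ha => (hmB a).1 ha) hq
  have h3 := card_nbrIn_of_mem (G := G) (hPA hp)
  have h4 := card_nbrIn_of_mem (G := G) (hQB hq)
  have h5 : (nbrIn Gᶜ A p).card ≤ (nbrIn Gᶜ (A ∩ B) p).card := Finset.card_le_card fun z hz => by
    rw [mem_nbrIn] at hz
    exact mem_nbrIn.2 ⟨Finset.mem_inter.2 ⟨hz.1, hPz p hp z hz.2⟩, hz.2⟩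
  have h6 : (nbrIn Gᶜ B q).card ≤ (nbrIn Gᶜ (A ∩ B) q).card := Finset.card_le_card fun z hz => by
    rw [mem_nbrIn] at hz
    exact mem_nbrIn.2 ⟨Finset.mem_inter.2 ⟨hQz q hq z hz.2, hz.1⟩, hz.2⟩
  omega

theorem card_ne_of_pairwiseAdj {n m : ℕ} (hn : 1 ≤ n) (hm : 5 * n + 3 ≤ m)
    (hV : Fintype.card V = 2 * m + 1) (hB : BookFree G n) (hW : WheelFree G m) {K : Finset V}
    (hK : PairwiseAdj G K) : K.card ≠ m := by
  intro hKm
  have hfew : ∀ y ∉ K, (nbrIn G K y).card ≤ 2 := by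
    intro y hy
    by_contra hcon
    push Not at hcon
    obtain ⟨a, b, c, ha, hb, hc, hab, hac, hbc⟩ := Finset.two_lt_card_iff.1 hcon
    rw [mem_nbrIn] at ha hb hc
    have hyK : y ∉ K.erase a := fun h => hy (Finset.mem_of_mem_erase h)
    refine hW a (insert y (K.erase a)) ?_ ?_ ⟨y, c, .cons hyK hb.2
      ((hK.mono (Finset.erase_subset a K)).spanningPath (Finset.mem_erase.2 ⟨hab.symm, hb.1⟩)
        (Finset.mem_erase.2 ⟨hac.symm, hc.1⟩) hbc), hc.2⟩
    · rw [Finset.card_insert_of_notMem hyK, Finset.card_erase_add_one ha.1, hKm]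
    · intro x hx
      rw [Finset.mem_insert, Finset.mem_erase] at hx
      rcases hx with rfl | hx
      · exact ha.2.symm
      · exact hK a ha.1 x hx.2 hx.1.symm
  have hc : PairwiseAdj G Kᶜ := by
    intro x hx y hy hxy
    by_contra hadj
    rw [Finset.mem_compl] at hx hy
    have h1 := hB x y ((SimpleGraph.compl_adj _ _ _).2 ⟨hxy, hadj⟩)
      (nbrIn Gᶜ K x ∩ nbrIn Gᶜ K y) fun z hz => by
        rw [Finset.mem_inter, mem_nbrIn, mem_nbrIn] at hz
        exact ⟨hz.1.2, hz.2.2⟩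
    have h2 := Finset.card_union_add_card_inter (nbrIn Gᶜ K x) (nbrIn Gᶜ K y)
    have h3 := Finset.card_le_card (Finset.union_subset (nbrIn_subset (G := Gᶜ) (s := K) (v := x))
      (nbrIn_subset (G := Gᶜ) (s := K) (v := y)))
    have h4 := card_nbrIn_of_notMem (G := G) hx
    have h5 := card_nbrIn_of_notMem (G := G) hy
    have h6 := hfew x hx
    have h7 := hfew y hy
    omega
  have h1 := hW.card_le_of_pairwiseAdj (by omega) hc
  rw [Finset.card_compl] at h1
  omega

theorem exists_card_nbrIn_compl_le {n m : ℕ} (hn : 1 ≤ n) (hm : 5 * n + 3 ≤ m)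
    (hV : Fintype.card V = 2 * m + 1) (hB : BookFree G n) (hW : WheelFree G m) :
    ∃ v, (nbrIn Gᶜ Finset.univ v).card ≤ m := by
  by_contra hcon
  push Not at hcon
  obtain ⟨y⟩ : Nonempty V := Fintype.card_pos_iff.1 (by omega)
  set X := nbrIn Gᶜ Finset.univ y with hX
  have hXn : NearClique G n X := hB.nearClique fun x hx => (mem_nbrIn.1 hx).2
  have hXc := hcon y
  rw [← hX] at hXc
  have hout : ∀ a ∈ X, m + 2 ≤ (nbrIn Gᶜ Xᶜ a).card + n := by
    intro a ha
    have h1 : nbrIn Gᶜ Finset.univ a ⊆ nbrIn Gᶜ X a ∪ nbrIn Gᶜ Xᶜ a := by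
      intro z hz
      rw [mem_nbrIn] at hz
      simp only [Finset.mem_union, mem_nbrIn, Finset.mem_compl, hz.2, and_true]
      tauto
    have h2 := (Finset.card_le_card h1).trans (Finset.card_union_le _ _)
    have h3 := hXn a ha
    have h4 := hcon a
    omega
  have hc : PairwiseAdj G X := by
    intro a ha b hb hab
    by_contra hadj
    have h1 := hB a b ((SimpleGraph.compl_adj _ _ _).2 ⟨hab, hadj⟩)
      (nbrIn Gᶜ Xᶜ a ∩ nbrIn Gᶜ Xᶜ b) fun z hz => by
        rw [Finset.mem_inter, mem_nbrIn, mem_nbrIn] at hz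
        exact ⟨hz.1.2, hz.2.2⟩
    have h2 := Finset.card_union_add_card_inter (nbrIn Gᶜ Xᶜ a) (nbrIn Gᶜ Xᶜ b)
    have h3 := Finset.card_le_card (Finset.union_subset (nbrIn_subset (G := Gᶜ) (s := Xᶜ) (v := a))
      (nbrIn_subset (G := Gᶜ) (s := Xᶜ) (v := b)))
    have h4 := hout a ha
    have h5 := hout b hb
    rw [Finset.card_compl, hV] at h3
    omega
  have := hW.card_le_of_pairwiseAdj (by omega) hc
  omega

theorem not_wheelFree_of_bookFree {n m : ℕ} (hn : 1 ≤ n) (hm : 5 * n + 3 ≤ m)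
    (hV : Fintype.card V = 2 * m + 1) (hB : BookFree G n) : ¬ WheelFree G m := by
  intro hW
  obtain ⟨v, hv⟩ := exists_card_nbrIn_compl_le hn hm hV hB hW
  have hTR := card_nbrIn_of_mem (G := G) (Finset.mem_univ v)
  rw [Finset.card_univ, hV] at hTR
  set T := nbrIn Gᶜ Finset.univ v with hT
  obtain ⟨P, Q, hP, hQ, hPn, hQn, hPQ, hcard⟩ := hW.almostSplit (h := v)
    (R := nbrIn G Finset.univ v) hn hm hB (fun x hx => (mem_nbrIn.1 hx).2) (by omega)
  wlog hle : P.card ≤ Q.card generalizing P Q with H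
  · exact H Q P hQ hP hQn hPn hPQ.symm (by omega) (by omega)
  have hTR' : ∀ t ∈ T, t ∉ nbrIn G Finset.univ v := fun t ht ht' =>
    ((SimpleGraph.compl_adj _ _ _).1 (mem_nbrIn.1 ht).2).2 (mem_nbrIn.1 ht').2
  have hTn : NearClique G n T := hB.nearClique fun x hx => (mem_nbrIn.1 hx).2
  have hQm := card_lt_of_anticomplete hn hm hB hW hPQ hPn fun q hq => (mem_nbrIn.1 (hQ hq)).2
  have hPsmall : P.card ≤ 2 * n := by
    by_contra hcon
    exact not_anticomplete hn hm hV hB hW (by omega) (by omega) hPQ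
  have hPc := hB.pairwiseAdj hPQ (by omega)
  obtain ⟨p₀, hp₀⟩ := hPn
  have hQnc : NearClique G n Q := hB.nearClique (hPQ p₀ hp₀)
  have hTQ : Disjoint T Q := Finset.disjoint_left.2 fun x hx hx' => hTR' x hx (hQ hx')
  have hTP' : Disjoint T P := Finset.disjoint_left.2 fun x hx hx' => hTR' x hx (hP hx')
  have hPQd := hPQ.disjoint
  by_cases hTP : ∀ t ∈ T, ∀ p ∈ P, G.Adj t p
  · have hTPc := Finset.card_union_of_disjoint hTP'
    have hTPn := hTn.union hn hPc hTP
    have hTPm : T.card + P.card = m := by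
      by_contra hne
      have hsub : T ∪ P.erase p₀ ⊆ T ∪ P := Finset.union_subset_union_right (Finset.erase_subset _ _)
      have h1 := hW.card_lt_of_nearClique hm (hTPn.mono hsub) (h := p₀) fun x hx => by
        rw [Finset.mem_union, Finset.mem_erase] at hx
        rcases hx with hx | hx
        · exact (hTP x hx p₀ hp₀).symm
        · exact hPc p₀ hp₀ x hx.2 hx.1.symm
      rw [Finset.card_union_of_disjoint (Finset.disjoint_of_subset_right
        (Finset.erase_subset _ _) hTP')] at h1
      have h2 := Finset.card_erase_add_one hp₀
      omega
    have hTc : ¬ PairwiseAdj G T := by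
      intro hTc
      refine card_ne_of_pairwiseAdj hn hm hV hB hW (K := T ∪ P) ?_ (hTPc.trans hTPm)
      intro x hx y hy hxy
      rcases Finset.mem_union.1 hx with hx | hx <;> rcases Finset.mem_union.1 hy with hy | hy
      · exact hTc x hx y hy hxy
      · exact hTP x hx y hy
      · exact (hTP y hy x hx).symm
      · exact hPc x hx y hy hxy
    unfold PairwiseAdj at hTc
    push Not at hTc
    obtain ⟨t, ht, t', ht', hne, hadj⟩ := hTc
    wlog hr : (nbrIn G Q t').card ≤ (nbrIn G Q t).card generalizing t t' with H
    · exact H t' ht' t ht hne.symm (fun h => hadj h.symm) (by omega)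
    have h1 := hB t t' ((SimpleGraph.compl_adj _ _ _).2 ⟨hne, hadj⟩)
      (nbrIn Gᶜ Q t ∩ nbrIn Gᶜ Q t') fun z hz => by
        rw [Finset.mem_inter, mem_nbrIn, mem_nbrIn] at hz
        exact ⟨hz.1.2, hz.2.2⟩
    have h2 := Finset.card_union_add_card_inter (nbrIn Gᶜ Q t) (nbrIn Gᶜ Q t')
    have h3 := Finset.card_le_card (Finset.union_subset (nbrIn_subset (G := Gᶜ) (s := Q) (v := t))
      (nbrIn_subset (G := Gᶜ) (s := Q) (v := t')))
    have h4 := card_nbrIn_of_notMem (G := G) (Finset.disjoint_left.1 hTQ ht)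
    have h5 := card_nbrIn_of_notMem (G := G) (Finset.disjoint_left.1 hTQ ht')
    have h6 := card_nbrIn_of_mem (G := G) ht
    have h7 := hTn t ht
    have hX : nbrIn G T t ∪ P ⊆ T ∪ P := Finset.union_subset_union_left nbrIn_subset
    have hXc := Finset.card_union_of_disjoint
      (Finset.disjoint_of_subset_left (nbrIn_subset (G := G) (v := t)) hTP')
    have hXY : Disjoint (nbrIn G T t ∪ P) (nbrIn G Q t) :=
      Finset.disjoint_of_subset_left hX (Finset.disjoint_of_subset_right nbrIn_subset
        (Finset.disjoint_union_left.2 ⟨hTQ, hPQd⟩))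
    have hXYc := Finset.card_union_of_disjoint hXY
    obtain ⟨P₁, Q₁, hP₁, hQ₁, hPQ₁, hc₁⟩ := (hW.almostSplit (h := t)
      (R := (nbrIn G T t ∪ P) ∪ nbrIn G Q t) hn hm hB (fun x hx => by
        simp only [Finset.mem_union, mem_nbrIn] at hx
        rcases hx with (hx | hx) | hx
        · exact hx.2
        · exact hTP t ht x hx
        · exact hx.2) (by omega)).exists_of_union (hTPn.mono hX) (by omega)
        (hQnc.mono nbrIn_subset) (by omega)
    have h8 := Finset.card_le_card hP₁
    have h9 := Finset.card_le_card hQ₁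
    exact not_anticomplete hn hm hV hB hW (by omega) (by omega) hPQ₁
  · push Not at hTP
    obtain ⟨t, ht, p, hp, htp⟩ := hTP
    have hbl : Gᶜ.Adj t p :=
      (SimpleGraph.compl_adj _ _ _).2 ⟨Finset.disjoint_iff_ne.1 hTP' t ht p hp, htp⟩
    have h1 := hB t p hbl (nbrIn Gᶜ Q t) fun z hz => by
      rw [mem_nbrIn] at hz
      exact ⟨hz.2, hPQ p hp z hz.1⟩
    have h2 := card_nbrIn_of_notMem (G := G) (Finset.disjoint_left.1 hTQ ht)
    have h3 := card_nbrIn_of_mem (G := G) ht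
    have h4 := hTn t ht
    have hXY : Disjoint (nbrIn G T t) (nbrIn G Q t) :=
      Finset.disjoint_of_subset_left nbrIn_subset
        (Finset.disjoint_of_subset_right nbrIn_subset hTQ)
    have hXYc := Finset.card_union_of_disjoint hXY
    obtain ⟨P₁, Q₁, hP₁, hQ₁, hPQ₁, hc₁⟩ := (hW.almostSplit (h := t)
      (R := nbrIn G T t ∪ nbrIn G Q t) hn hm hB (fun x hx => by
        simp only [Finset.mem_union, mem_nbrIn] at hx
        rcases hx with hx | hx <;> exact hx.2) (by omega)).exists_of_union
        (hTn.mono nbrIn_subset) (by omega) (hQnc.mono nbrIn_subset) (by omega)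
    have h8 := Finset.card_le_card hP₁
    have h9 := Finset.card_le_card hQ₁
    exact not_anticomplete hn hm hV hB hW (by omega) (by omega) hPQ₁

theorem containsCopy_wheelGraph_or_bookGraph {n m : ℕ} (hn : 1 ≤ n) (hm : 5 * n + 3 ≤ m)
    (hV : Fintype.card V = 2 * m + 1) (G : SimpleGraph V) :
    ContainsCopy G (wheelGraph m) ∨ ContainsCopy Gᶜ (bookGraph n) := by
  by_contra hcon
  rw [not_or] at hcon
  refine not_wheelFree_of_bookFree (G := G) hn hm hV ?_ ?_
  · intro u w huw s hs
    by_contra hlt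
    exact hcon.2 (containsCopy_bookGraph huw hs (not_lt.1 hlt))
  · rintro h s rfl hs hc
    exact hcon.1 (hc.containsCopy_wheelGraph hs)

end Fintype

end

/-- The disjoint union of two cliques on `m` vertices each. -/
def twoCliques (m : ℕ) : SimpleGraph (Fin (2 * m)) where
  Adj x y := x ≠ y ∧ (x.val < m ↔ y.val < m)
  symm := ⟨fun _ _ h => ⟨h.1.symm, h.2.symm⟩⟩
  loopless := ⟨fun _ h => h.1 rfl⟩

theorem not_containsCopy_wheelGraph_twoCliques (m : ℕ) :
    ¬ ContainsCopy (twoCliques m) (wheelGraph m) := by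
  rintro ⟨f, hf⟩
  have hside : ∀ x, ((f x).val < m ↔ (f none).val < m) := by
    intro x
    by_cases hx : x = none
    · rw [hx]
    · have hadj : (wheelGraph m).Adj none x := by
        rw [wheelGraph, SimpleGraph.fromRel_adj]
        exact ⟨Ne.symm hx, .inl (.inl rfl)⟩
      exact (f.map_adj hadj).2.symm
  by_cases h : (f none).val < m
  · have := Fintype.card_le_of_injective (β := Fin m)
      (fun x => ⟨(f x).val, (hside x).2 h⟩) fun x y hxy => hf (Fin.ext (Fin.mk.inj_iff.1 hxy))
    simp at this
  · have := Fintype.card_le_of_injective (β := Fin m)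
      (fun x => ⟨(f x).val - m, by have := (f x).isLt; omega⟩) fun x y hxy => by
        have h1 := Fin.mk.inj_iff.1 hxy
        have h2 := (hside x).not.2 h
        have h3 := (hside y).not.2 h
        exact hf (Fin.ext (by omega))
    simp at this

theorem not_containsCopy_bookGraph_compl_twoCliques {n : ℕ} (hn : 1 ≤ n) (m : ℕ) :
    ¬ ContainsCopy (twoCliques m)ᶜ (bookGraph n) := by
  rintro ⟨f, hf⟩
  have hadj : ∀ x y : Fin 2 ⊕ Fin n, x ≠ y → x.isLeft →
      ¬ ((f x).val < m ↔ (f y).val < m) := by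
    intro x y hxy hx hiff
    have h : (bookGraph n).Adj x y := by
      rw [bookGraph, SimpleGraph.fromRel_adj]
      exact ⟨hxy, .inl ⟨hx, hxy⟩⟩
    have h' := f.map_adj h
    rw [SimpleGraph.compl_adj] at h'
    exact h'.2 ⟨h'.1, hiff⟩
  have h1 := hadj (.inl 0) (.inl 1) (by simp) rfl
  have h2 := hadj (.inl 0) (.inr ⟨0, hn⟩) (by simp) rfl
  have h3 := hadj (.inl 1) (.inr ⟨0, hn⟩) (by simp) rfl
  tauto

/-- For all integers `n ≥ 1` and `m ≥ 5n + 3`, the Ramsey number `R(W_m, B_n)` equals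
`2m + 1`. -/
theorem statement14 (n m : ℕ) (hn : 1 ≤ n) (hm : 5 * n + 3 ≤ m) :
    (∀ Γ : SimpleGraph (Fin (2 * m + 1)),
        ContainsCopy Γ (wheelGraph m) ∨ ContainsCopy Γᶜ (bookGraph n)) ∧
    (∃ Γ : SimpleGraph (Fin (2 * m)),
        ¬ ContainsCopy Γ (wheelGraph m) ∧ ¬ ContainsCopy Γᶜ (bookGraph n)) := by
  refine ⟨fun Γ => containsCopy_wheelGraph_or_bookGraph hn hm (Fintype.card_fin _) Γ,
    twoCliques m, not_containsCopy_wheelGraph_twoCliques m,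
    not_containsCopy_bookGraph_compl_twoCliques hn m⟩
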